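/- arXiv:1406.4380 — 7 statements merged into one kernel-verified Lean document; each statement's English description precedes it below -/
import Mathlib

section
/- Let r = 2ℓ be an even integer with ℓ ≥ 2, and let G be a graph with maximum degree Δ ≥ 3. Then the r-acyclic choice number of G satisfies A_r^l(G) ≤ ⌈ Δ^ℓ + (3/2)·(r+2)²·Δ^((r+1)/3) ⌉. -/
/-- An `r`-acyclic coloring is a proper vertex coloring such that every cycle `C`
receives at least `min |C| r` distinct colors. -/
def IsRAcyclicColoring {V : Type} (G : SimpleGraph V) (r : ℕ) (c : V → ℕ) : Prop :=
  (∀ u v, G.Adj u v → c u ≠ c v) ∧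
  ∀ (v : V) (w : G.Walk v v), w.IsCycle → min w.length r ≤ (w.support.map c).toFinset.card

/-- The `r`-acyclic choice number: the least `k` such that for every assignment of
lists of size `k` to the vertices there is an `r`-acyclic coloring from the lists. -/
noncomputable def rAcyclicChoiceNumber {V : Type} (G : SimpleGraph V) (r : ℕ) : ℕ :=
  sInf {k | ∀ L : V → Finset ℕ, (∀ v, (L v).card = k) →
    ∃ c : V → ℕ, (∀ v, c v ∈ L v) ∧ IsRAcyclicColoring G r c}

section Counting

variable {V : Type}

/-- The three pairs `a, b`, `c, d`, `e, h` of vertices of `S` are disjoint and each of them is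
monochromatic under `f`. -/
def ThreePairs (f : V → ℕ) (S : Finset V) (a b c d e h : V) : Prop :=
  [a, b, c, d, e, h].Nodup ∧ (∀ x ∈ [a, b, c, d, e, h], x ∈ S) ∧ f a = f b ∧ f c = f d ∧ f e = f h

/-- On `S`, the coloring `f` separates conflicting vertices, and no sequence in `P` has three
disjoint monochromatic pairs. -/
def IsGoodOn {n : ℕ} (conf : V → Finset V) (P : Finset (Fin n → V)) (S : Finset V)
    (f : V → ℕ) : Prop :=
  (∀ u ∈ S, ∀ w ∈ S, w ∈ conf u → f u ≠ f w) ∧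
  ∀ p ∈ P, ∀ a b c d e h, ¬ ThreePairs f S (p a) (p b) (p c) (p d) (p e) (p h)

variable {n : ℕ} {conf : V → Finset V} {P : Finset (Fin n → V)} {S : Finset V}

theorem IsGoodOn.mono {T : Finset V} {f g : V → ℕ} (hf : IsGoodOn conf P S f) (hTS : T ⊆ S)
    (hfg : ∀ u ∈ T, g u = f u) : IsGoodOn conf P T g := by
  refine ⟨fun u hu w hw hc => ?_, fun p hp a b c d e h ht => ?_⟩
  · rw [hfg u hu, hfg w hw]
    exact hf.1 u (hTS hu) w (hTS hw) hc
  · obtain ⟨hnd, hmem, h1, h2, h3⟩ := ht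
    refine hf.2 p hp a b c d e h ⟨hnd, fun x hx => hTS (hmem x hx), ?_⟩
    simp only [List.forall_mem_cons] at hmem
    obtain ⟨ha, hb, hc, hd, he, hh, -⟩ := hmem
    rw [hfg _ ha, hfg _ hb] at h1
    rw [hfg _ hc, hfg _ hd] at h2
    rw [hfg _ he, hfg _ hh] at h3
    exact ⟨h1, h2, h3⟩

theorem two_mul_card_filter_lt_le (n : ℕ) :
    2 * (Finset.univ.filter fun q : Fin n × Fin n => q.1 < q.2).card ≤ n ^ 2 := by
  have h1 : (Finset.univ.filter fun q : Fin n × Fin n => q.1 < q.2).card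
      = (Finset.univ.filter fun q : Fin n × Fin n => q.2 < q.1).card :=
    Finset.card_equiv (Equiv.prodComm _ _) (by simp)
  have h2 : Disjoint (Finset.univ.filter fun q : Fin n × Fin n => q.1 < q.2)
      (Finset.univ.filter fun q : Fin n × Fin n => q.2 < q.1) :=
    Finset.disjoint_filter.2 fun q _ h => h.asymm
  have h3 := Finset.card_le_univ ((Finset.univ.filter fun q : Fin n × Fin n => q.1 < q.2) ∪
      (Finset.univ.filter fun q : Fin n × Fin n => q.2 < q.1))
  rw [Finset.card_union_of_disjoint h2, Fintype.card_prod, Fintype.card_fin] at h3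
  linarith [sq n]

/-- The codes `((i, p), j, (c, d), (e, h))` of the ways in which a sequence of `P` through `v` can
have three monochromatic pairs one of which contains `v`. -/
def patterns [DecidableEq V] (P : Finset (Fin n → V)) (v : V) :
    Finset (((_ : Fin n) × (Fin n → V)) × Fin n × (Fin n × Fin n) × (Fin n × Fin n)) :=
  (Finset.univ.sigma fun i => {p ∈ P | p i = v}) ×ˢ Finset.univ ×ˢ
    (Finset.univ.filter fun q => q.1 < q.2) ×ˢ Finset.univ

theorem two_mul_card_patterns_le [DecidableEq V] {M : ℕ} {v : V}
    (hM : ∀ i, {p ∈ P | p i = v}.card ≤ M) : 2 * (patterns P v).card ≤ n ^ 6 * M := by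
  have h1 : ∑ i, {p ∈ P | p i = v}.card ≤ n * M := by
    simpa using Finset.sum_le_card_nsmul Finset.univ _ M fun i _ => hM i
  simp only [patterns, Finset.card_product, Finset.card_sigma, Finset.card_univ, Fintype.card_prod,
    Fintype.card_fin]
  calc 2 * ((∑ i, {p ∈ P | p i = v}.card) *
        (n * ((Finset.univ.filter fun q : Fin n × Fin n => q.1 < q.2).card * (n * n))))
      = (∑ i, {p ∈ P | p i = v}.card) * n ^ 3 *
        (2 * (Finset.univ.filter fun q : Fin n × Fin n => q.1 < q.2).card) := by ring
    _ ≤ (n * M) * n ^ 3 * n ^ 2 := by gcongr; exact two_mul_card_filter_lt_le n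
    _ = n ^ 6 * M := by ring

variable [Fintype V] {L : V → Finset ℕ}

open Classical in
/-- The good list colorings of `S`, extended by `0` outside `S`. -/
noncomputable def goodColorings (conf : V → Finset V) (P : Finset (Fin n → V))
    (L : V → Finset ℕ) (S : Finset V) : Finset (V → ℕ) :=
  {f ∈ Fintype.piFinset (fun u => if u ∈ S then L u else {0}) | IsGoodOn conf P S f}

theorem mem_goodColorings {f : V → ℕ} :
    f ∈ goodColorings conf P L S ↔
      (∀ u ∈ S, f u ∈ L u) ∧ (∀ u ∉ S, f u = 0) ∧ IsGoodOn conf P S f := by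
  classical
  simp only [goodColorings, Finset.mem_filter, Fintype.mem_piFinset, ← and_assoc]
  refine and_congr_left fun _ => ⟨fun h => ⟨fun u hu => ?_, fun u hu => ?_⟩, fun h u => ?_⟩
  · simpa [hu] using h u
  · simpa [hu] using h u
  · by_cases hu : u ∈ S
    · simpa [hu] using h.1 u hu
    · simpa [hu] using h.2 u hu

theorem restrict_mem_goodColorings {T : Finset V} {f : V → ℕ} [DecidableEq V]
    (hf : f ∈ goodColorings conf P L S) (hTS : T ⊆ S) :
    (fun u => if u ∈ T then f u else 0) ∈ goodColorings conf P L T := by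
  rw [mem_goodColorings] at hf ⊢
  refine ⟨fun u hu => ?_, fun u hu => if_neg hu, hf.2.2.mono hTS fun u hu => if_pos hu⟩
  simpa [hu] using hf.1 u (hTS hu)

open Classical in
/-- The colorings of `insert v S` from the lists whose restriction to `S` is good. -/
noncomputable def extensions (conf : V → Finset V) (P : Finset (Fin n → V))
    (L : V → Finset ℕ) (S : Finset V) (v : V) : Finset (V → ℕ) :=
  ((goodColorings conf P L S) ×ˢ L v).image fun q => Function.update q.1 v q.2

theorem mem_extensions {v : V} (hv : v ∉ S) {g : V → ℕ} [DecidableEq V] :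
    g ∈ extensions conf P L S v ↔
      g v ∈ L v ∧ Function.update g v 0 ∈ goodColorings conf P L S := by
  classical
  simp only [extensions, Finset.mem_image, Finset.mem_product, Prod.exists]
  constructor
  · rintro ⟨f, x, ⟨hf, hx⟩, rfl⟩
    have : f v = 0 := (mem_goodColorings.1 hf).2.1 v hv
    refine ⟨by simpa using hx, ?_⟩
    convert hf using 1
    ext u
    by_cases hu : u = v
    · subst hu; simp [this]
    · simp [hu]
  · rintro ⟨h1, h2⟩
    refine ⟨_, _, ⟨h2, h1⟩, ?_⟩
    ext u
    by_cases hu : u = v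
    · subst hu; simp
    · simp [hu]

theorem card_extensions {v : V} (hv : v ∉ S) :
    (extensions conf P L S v).card = (goodColorings conf P L S).card * (L v).card := by
  classical
  rw [extensions, Finset.card_image_of_injOn, Finset.card_product]
  rintro ⟨f, x⟩ hf ⟨g, y⟩ hg hfg
  simp only [Finset.coe_product, Set.mem_prod, Finset.mem_coe] at hf hg hfg
  have h1 : f v = 0 := (mem_goodColorings.1 hf.1).2.1 v hv
  have h2 : g v = 0 := (mem_goodColorings.1 hg.1).2.1 v hv
  have hxy : x = y := by simpa using congrFun hfg v
  subst hxy
  refine Prod.ext (funext fun u => ?_) rfl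
  by_cases hu : u = v
  · subst hu; exact h1.trans h2.symm
  · simpa [hu] using congrFun hfg u

theorem card_extensions_conflict_le {v : V} (hv : v ∉ S) {u : V} (huv : u ≠ v) [DecidableEq V] :
    {g ∈ extensions conf P L S v | g v = g u}.card ≤ (goodColorings conf P L S).card := by
  refine Finset.card_le_card_of_injOn (fun g => Function.update g v 0) ?_ ?_
  · intro g hg
    exact ((mem_extensions hv).1 (Finset.mem_filter.1 hg).1).2
  · intro f hf g hg hfg
    have hf := (Finset.mem_filter.1 hf).2
    have hg := (Finset.mem_filter.1 hg).2
    have key : ∀ w, w ≠ v → f w = g w := fun w hw => by simpa [hw] using congrFun hfg w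
    ext w
    by_cases hw : w = v
    · rw [hw, hf, hg, key u huv]
    · exact key w hw

open Classical in
theorem card_extensions_threePairs_le {v : V} (hv : v ∉ S) (b c d e h : V) :
    {g ∈ extensions conf P L S v | ThreePairs g (insert v S) v b c d e h}.card ≤
      (goodColorings conf P L ((S.erase c).erase e)).card := by
  refine Finset.card_le_card_of_injOn
    (fun g => fun u => if u ∈ (S.erase c).erase e then g u else 0) ?_ ?_
  · intro g hg
    rw [Finset.mem_coe]
    have hg := ((mem_extensions hv).1 (Finset.mem_filter.1 hg).1).2
    convert restrict_mem_goodColorings hg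
      ((Finset.erase_subset e _).trans (Finset.erase_subset c S)) using 1
    ext u
    refine ite_congr rfl (fun hu => (Function.update_of_ne ?_ _ _).symm) fun _ => rfl
    rintro rfl
    exact hv (Finset.mem_of_mem_erase (Finset.mem_of_mem_erase hu))
  · intro f hf g hg hfg
    obtain ⟨hfE, hnd, hmem, f1, f2, f3⟩ := Finset.mem_filter.1 hf
    obtain ⟨hgE, -, -, g1, g2, g3⟩ := Finset.mem_filter.1 hg
    have hf0 := (mem_goodColorings.1 ((mem_extensions hv).1 hfE).2).2.1
    have hg0 := (mem_goodColorings.1 ((mem_extensions hv).1 hgE).2).2.1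
    have key : ∀ w, w ≠ v → w ≠ c → w ≠ e → f w = g w := fun w hw1 hw2 hw3 => by
      by_cases hw : w ∈ S
      · simpa [hw, hw1, hw2, hw3] using congrFun hfg w
      · simpa [hw1] using (hf0 w hw).trans (hg0 w hw).symm
    simp only [List.nodup_cons, List.mem_cons, List.not_mem_nil, not_or] at hnd
    ext w
    by_cases hw1 : w = v
    · rw [hw1, f1, g1]; apply key <;> grind
    by_cases hw2 : w = c
    · rw [hw2, f2, g2]; apply key <;> grind
    by_cases hw3 : w = e
    · rw [hw3, f3, g3]; apply key <;> grind
    exact key w hw1 hw2 hw3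

open Classical in
theorem extensions_subset {v : V} (hv : v ∉ S)
    (hsymm : ∀ u w, u ∈ conf w → w ∈ conf u) :
    extensions conf P L S v ⊆ goodColorings conf P L (insert v S) ∪
      ((conf v).biUnion fun u => {g ∈ extensions conf P L S v | g v = g u}) ∪
      (patterns P v).biUnion fun q => {g ∈ extensions conf P L S v |
        ThreePairs g (insert v S) v (q.1.2 q.2.1) (q.1.2 q.2.2.1.1) (q.1.2 q.2.2.1.2)
          (q.1.2 q.2.2.2.1) (q.1.2 q.2.2.2.2)} := by
  intro g hg
  by_contra hcon
  simp only [Finset.mem_union, Finset.mem_biUnion, Finset.mem_filter, hg, true_and, not_or,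
    not_exists, not_and, Prod.forall, Sigma.forall] at hcon
  obtain ⟨⟨hbad, hconf⟩, hpat⟩ := hcon
  have hlt : ∀ p ∈ P, ∀ a b c d e h, p a = v → c < d →
      ¬ ThreePairs g (insert v S) (p a) (p b) (p c) (p d) (p e) (p h) := by
    intro p hp a b c d e h ha hcd ht
    rw [ha] at ht
    exact hpat a p b c d e h (by simp [patterns, hp, ha, hcd]) ht
  have hne : ∀ p ∈ P, ∀ a b c d e h, p a = v →
      ¬ ThreePairs g (insert v S) (p a) (p b) (p c) (p d) (p e) (p h) := by
    intro p hp a b c d e h ha ht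
    rcases lt_trichotomy c d with hcd | hcd | hcd
    · exact hlt p hp a b c d e h ha hcd ht
    · subst hcd
      have := ht.1
      simp at this
    · refine hlt p hp a b d c e h ha hcd ?_
      unfold ThreePairs at ht ⊢
      simp only [List.nodup_cons, List.mem_cons, List.not_mem_nil] at ht ⊢
      grind
  obtain ⟨hgv, hgS⟩ := (mem_extensions hv).1 hg
  rw [mem_goodColorings] at hgS
  obtain ⟨h1, h2, h3⟩ := hgS
  have hupd : ∀ u, u ≠ v → Function.update g v 0 u = g u := fun u hu => by simp [hu]
  have hS : ∀ u ∈ S, u ≠ v := fun u hu huv => hv (huv ▸ hu)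
  refine hbad (mem_goodColorings.2 ⟨?_, ?_, ?_, ?_⟩)
  · intro u hu
    rcases Finset.mem_insert.1 hu with rfl | hu
    · exact hgv
    · rw [← hupd u (hS u hu)]
      exact h1 u hu
  · intro u hu
    rw [Finset.mem_insert, not_or] at hu
    rw [← hupd u hu.1]
    exact h2 u hu.2
  · intro u hu w hw hc
    rcases Finset.mem_insert.1 hu with rfl | hu
    · exact hconf w hc
    rcases Finset.mem_insert.1 hw with rfl | hw
    · exact fun h => hconf u (hsymm _ _ hc) h.symm
    · rw [← hupd u (hS u hu), ← hupd w (hS w hw)]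
      exact h3.1 u hu w hw hc
  · intro p hp a b c d e h ht
    by_cases hvm : v ∈ [p a, p b, p c, p d, p e, p h]
    · have h1 := hne p hp a b c d e h
      have h2 := hne p hp b a c d e h
      have h3 := hne p hp c d a b e h
      have h4 := hne p hp d c a b e h
      have h5 := hne p hp e h a b c d
      have h6 := hne p hp h e a b c d
      clear hne hlt hpat hconf hbad
      unfold ThreePairs at *
      simp only [List.nodup_cons, List.mem_cons, List.not_mem_nil] at *
      grind
    · have hgood : IsGoodOn conf P S g := h3.mono subset_rfl fun u hu => (hupd u (hS u hu)).symm
      refine hgood.2 p hp a b c d e h ⟨ht.1, fun x hx => ?_, ht.2.2⟩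
      exact Finset.mem_of_mem_insert_of_ne (ht.2.1 x hx) fun hxv => hvm (hxv ▸ hx)

open Classical in
theorem mul_card_goodColorings_le {k D M : ℕ} {β : ℝ} (hβ : 0 < β)
    (hL : ∀ v, (L v).card = k) (hsymm : ∀ u w, u ∈ conf w → w ∈ conf u)
    (hirr : ∀ u, u ∉ conf u) (hD : ∀ u, (conf u).card ≤ D)
    (hM : ∀ (v : V) (i : Fin n), {p : Fin n → V | p ∈ P ∧ p i = v}.ncard ≤ M)
    (hk : D + β + (n ^ 6 * M / 2) / β ^ 2 ≤ k) {v : V} (hv : v ∉ S) :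
    β * (goodColorings conf P L S).card ≤ ((goodColorings conf P L (insert v S)).card : ℝ) := by
  induction hm : S.card using Nat.strong_induction_on generalizing S v with
  | _ m ih =>
  subst hm
  have step : ∀ T ⊆ S, ∀ c ∈ T, β * (goodColorings conf P L (T.erase c)).card ≤
      ((goodColorings conf P L T).card : ℝ) := by
    intro T hT c hc
    have := ih (T.erase c).card
      ((Finset.card_erase_lt_of_mem hc).trans_le (Finset.card_le_card hT))
      (Finset.notMem_erase c T) rfl
    rwa [Finset.insert_erase hc] at this
  have hB : ∀ b c d e h : V,
      ({g ∈ extensions conf P L S v | ThreePairs g (insert v S) v b c d e h}.card : ℝ) ≤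
        (goodColorings conf P L S).card / β ^ 2 := by
    intro b c d e h
    rw [le_div_iff₀ (by positivity)]
    by_cases hce : c ∈ S ∧ e ∈ S ∧ c ≠ e
    · obtain ⟨hc, he, hne⟩ := hce
      have h1 := step (S.erase c) (Finset.erase_subset c S) e (Finset.mem_erase.2 ⟨hne.symm, he⟩)
      have h2 := step S subset_rfl c hc
      have h3 : ({g ∈ extensions conf P L S v |
          ThreePairs g (insert v S) v b c d e h}.card : ℝ) ≤ _ :=
        Nat.cast_le.2 (card_extensions_threePairs_le hv b c d e h)
      nlinarith
    · rw [Finset.filter_false_of_mem]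
      · simp
      · rintro g - ⟨hnd, hmem, -⟩
        simp only [List.nodup_cons, List.mem_cons, List.not_mem_nil,
          Finset.mem_insert] at hnd hmem
        grind
  have hpat : ((patterns P v).card : ℝ) ≤ n ^ 6 * M / 2 := by
    have h : 2 * (patterns P v).card ≤ n ^ 6 * M := two_mul_card_patterns_le fun i => by
      have := hM v i
      rwa [← Set.ncard_coe_finset, Finset.coe_filter]
    have h' : (2 : ℝ) * (patterns P v).card ≤ n ^ 6 * M := by exact_mod_cast h
    linarith
  have hcard := (Finset.card_le_card (extensions_subset (P := P) (L := L) hv hsymm)).trans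
    ((Finset.card_union_le _ _).trans (Nat.add_le_add_right (Finset.card_union_le _ _) _))
  rw [card_extensions hv, hL] at hcard
  have hA := Finset.card_biUnion_le (s := conf v)
    (t := fun u => {g ∈ extensions conf P L S v | g v = g u})
  have hA' := Finset.sum_le_card_nsmul (conf v)
    (fun u => {g ∈ extensions conf P L S v | g v = g u}.card) (goodColorings conf P L S).card
    fun u hu => card_extensions_conflict_le hv fun h => hirr u (by rwa [← h] at hu)
  have hC : ((((patterns P v).biUnion fun q => {g ∈ extensions conf P L S v |
        ThreePairs g (insert v S) v (q.1.2 q.2.1) (q.1.2 q.2.2.1.1) (q.1.2 q.2.2.1.2)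
          (q.1.2 q.2.2.2.1) (q.1.2 q.2.2.2.2)}).card : ℕ) : ℝ) ≤
      (n ^ 6 * M / 2) * ((goodColorings conf P L S).card / β ^ 2) := by
    refine (Nat.cast_le.2 Finset.card_biUnion_le).trans ?_
    rw [Nat.cast_sum]
    refine (Finset.sum_le_card_nsmul _ _ _ fun q _ => hB _ _ _ _ _).trans ?_
    rw [nsmul_eq_mul]
    gcongr
  have hAD : (((conf v).biUnion fun u => {g ∈ extensions conf P L S v | g v = g u}).card : ℝ) ≤
      D * (goodColorings conf P L S).card := by
    have h : ((conf v).biUnion fun u => {g ∈ extensions conf P L S v | g v = g u}).card ≤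
        D * (goodColorings conf P L S).card :=
      hA.trans (hA'.trans (by rw [smul_eq_mul]; gcongr; exact hD v))
    exact_mod_cast h
  have hcard' := (Nat.cast_le (α := ℝ)).2 hcard
  push_cast at hcard'
  have hk' := mul_le_mul_of_nonneg_left hk (Nat.cast_nonneg (α := ℝ) (goodColorings conf P L S).card)
  have hsplit : ((goodColorings conf P L S).card : ℝ) * (D + β + (n ^ 6 * M / 2) / β ^ 2) =
      D * (goodColorings conf P L S).card + β * (goodColorings conf P L S).card +
        (n ^ 6 * M / 2) * ((goodColorings conf P L S).card / β ^ 2) := by ring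
  linarith

theorem exists_isGoodOn_univ {k D M : ℕ} {β : ℝ} (hβ : 0 < β)
    (hL : ∀ v, (L v).card = k) (hsymm : ∀ u w, u ∈ conf w → w ∈ conf u)
    (hirr : ∀ u, u ∉ conf u) (hD : ∀ u, (conf u).card ≤ D)
    (hM : ∀ (v : V) (i : Fin n), {p : Fin n → V | p ∈ P ∧ p i = v}.ncard ≤ M)
    (hk : D + β + (n ^ 6 * M / 2) / β ^ 2 ≤ k) :
    ∃ f : V → ℕ, (∀ v, f v ∈ L v) ∧ IsGoodOn conf P Finset.univ f := by
  classical
  have hpos : ∀ S : Finset V, 0 < (goodColorings conf P L S).card := by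
    intro S
    induction S using Finset.induction_on with
    | empty =>
      refine Finset.card_pos.2 ⟨0, mem_goodColorings.2 ⟨by simp, by simp, by simp, ?_⟩⟩
      rintro p - a b c d e h ⟨-, hmem, -⟩
      exact absurd (hmem (p a) (by simp)) (Finset.notMem_empty _)
    | insert v S hv ih =>
      have h := mul_card_goodColorings_le hβ hL hsymm hirr hD hM hk hv
      have : (0 : ℝ) < β * (goodColorings conf P L S).card := by positivity
      exact_mod_cast this.trans_le h
  obtain ⟨f, hf⟩ := Finset.card_pos.1 (hpos Finset.univ)
  rw [mem_goodColorings] at hf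
  exact ⟨f, fun v => hf.1 v (Finset.mem_univ v), hf.2.2⟩

end Counting

section Graph

variable {V : Type} (G : SimpleGraph V)

/-- `u` and `v` are joined by a walk of length at most `m`. -/
def Near (m : ℕ) (u v : V) : Prop := ∃ w : G.Walk u v, w.length ≤ m

variable {G} {m : ℕ} {u v : V}

theorem Near.symm (h : Near G m u v) : Near G m v u :=
  let ⟨w, hw⟩ := h
  ⟨w.reverse, by rwa [SimpleGraph.Walk.length_reverse]⟩

theorem Near.mono {m' : ℕ} (h : Near G m u v) (hm : m ≤ m') : Near G m' u v :=
  let ⟨w, hw⟩ := h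
  ⟨w, hw.trans hm⟩

theorem Near.trans {m' : ℕ} {x : V} (h : Near G m u v) (h' : Near G m' v x) :
    Near G (m + m') u x :=
  let ⟨w, hw⟩ := h
  let ⟨w', hw'⟩ := h'
  ⟨w.append w', by rw [SimpleGraph.Walk.length_append]; omega⟩

theorem near_succ_iff : Near G (m + 1) u v ↔ u = v ∨ ∃ x, G.Adj u x ∧ Near G m x v := by
  constructor
  · rintro ⟨w, hw⟩
    cases w with
    | nil => exact Or.inl rfl
    | cons h q => exact Or.inr ⟨_, h, q, by simpa using hw⟩
  · rintro (rfl | ⟨x, hx, q, hq⟩)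
    · exact ⟨.nil, by simp⟩
    · exact ⟨.cons hx q, by simpa using hq⟩

theorem near_getVert (w : G.Walk u v) (i d : ℕ) :
    Near G d (w.getVert i) (w.getVert (i + d)) := by
  induction d with
  | zero => exact ⟨.nil, by simp⟩
  | succ d ih =>
    rcases lt_or_ge (i + d) w.length with h | h
    · exact ih.trans ⟨(w.adj_getVert_succ h).toWalk, by simp⟩
    · have hv : w.getVert (i + (d + 1)) = w.getVert (i + d) :=
        (w.getVert_of_length_le (by omega)).trans (w.getVert_of_length_le h).symm
      rw [hv]
      exact ih.mono d.le_succ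

variable [Fintype V]

open Classical in
/-- The vertices other than `v` at distance at most `m` from `v`. -/
noncomputable def puncturedBall (G : SimpleGraph V) (m : ℕ) (v : V) : Finset V :=
  {u | u ≠ v ∧ Near G m u v}

theorem mem_puncturedBall : u ∈ puncturedBall G m v ↔ u ≠ v ∧ Near G m u v := by
  simp [puncturedBall]

theorem card_puncturedBall_le [DecidableRel G.Adj] {Δ : ℕ} (hΔ : ∀ v, G.degree v ≤ Δ)
    (hpos : 1 ≤ Δ) (hm : 1 ≤ m) (v : V) : (puncturedBall G m v).card ≤ Δ ^ m := by
  classical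
  induction m, hm using Nat.le_induction with
  | base =>
    rw [pow_one]
    refine (Finset.card_le_card fun u hu => ?_).trans (hΔ v)
    obtain ⟨hne, hu⟩ := mem_puncturedBall.1 hu
    rcases near_succ_iff.1 hu with h | ⟨x, hx, w, hw⟩
    · exact absurd h hne
    · have := SimpleGraph.Walk.eq_of_length_eq_zero (Nat.le_zero.1 hw)
      rw [SimpleGraph.mem_neighborFinset]
      exact this ▸ hx.symm
  | succ m hm ih =>
    have hsub : puncturedBall G (m + 1) v ⊆ puncturedBall G m v ∪
        (puncturedBall G m v).biUnion fun u => (G.neighborFinset u).filter (¬ Near G m · v) := by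
      intro x hx
      obtain ⟨hne, hx⟩ := mem_puncturedBall.1 hx
      by_cases hxm : Near G m x v
      · exact Finset.mem_union_left _ (mem_puncturedBall.2 ⟨hne, hxm⟩)
      refine Finset.mem_union_right _ (Finset.mem_biUnion.2 ?_)
      rcases near_succ_iff.1 hx with h | ⟨u, hu, hw⟩
      · exact absurd h hne
      · refine ⟨u, mem_puncturedBall.2 ⟨?_, hw⟩, by simp [hu.symm, hxm]⟩
        rintro rfl
        exact hxm ⟨hu.toWalk, by simpa using hm⟩
    have hdeg : ∀ u ∈ puncturedBall G m v,
        ((G.neighborFinset u).filter (¬ Near G m · v)).card ≤ Δ - 1 := by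
      intro u hu
      obtain ⟨hne, hu⟩ := mem_puncturedBall.1 hu
      obtain ⟨k, rfl⟩ : ∃ k, m = k + 1 := ⟨m - 1, by omega⟩
      rcases near_succ_iff.1 hu with h | ⟨x, hx, hw⟩
      · exact absurd h hne
      refine Nat.le_sub_one_of_lt (lt_of_lt_of_le (Finset.card_lt_card ?_) (hΔ u))
      refine (Finset.ssubset_iff_of_subset (Finset.filter_subset _ _)).2
        ⟨x, by simpa using hx, fun h => (Finset.mem_filter.1 h).2 (hw.mono k.le_succ)⟩
    calc (puncturedBall G (m + 1) v).card
        ≤ (puncturedBall G m v).card + (puncturedBall G m v).card * (Δ - 1) :=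
          (Finset.card_le_card hsub).trans ((Finset.card_union_le _ _).trans
            (Nat.add_le_add_left (Finset.card_biUnion_le_card_mul _ _ _ hdeg) _))
      _ = (puncturedBall G m v).card * Δ := by
          obtain ⟨k, rfl⟩ : ∃ k, Δ = k + 1 := ⟨Δ - 1, by omega⟩
          simp only [Nat.add_sub_cancel]
          ring
      _ ≤ Δ ^ (m + 1) := by rw [pow_succ]; gcongr

open Classical in
/-- The sequences of `n + 1` successively adjacent vertices. -/
noncomputable def walkSeqs (G : SimpleGraph V) (n : ℕ) : Finset (Fin (n + 1) → V) :=
  {p | ∀ i : Fin n, G.Adj (p i.castSucc) (p i.succ)}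

theorem mem_walkSeqs {n : ℕ} {p : Fin (n + 1) → V} :
    p ∈ walkSeqs G n ↔ ∀ i : Fin n, G.Adj (p i.castSucc) (p i.succ) := by
  simp [walkSeqs]

theorem ncard_walkSeqs_le [DecidableRel G.Adj] {Δ : ℕ} (hΔ : ∀ v, G.degree v ≤ Δ) {n : ℕ}
    (i : Fin (n + 1)) (v : V) : {p | p ∈ walkSeqs G n ∧ p i = v}.ncard ≤ Δ ^ n := by
  classical
  have hport : ∀ u, ∃ f : V → Fin (Δ + 1), (∀ x, G.Adj u x → (f x : ℕ) < Δ) ∧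
      ∀ x y, G.Adj u x → G.Adj u y → f x = f y → x = y := by
    intro u
    let e := (G.neighborFinset u).equivFin
    refine ⟨fun x => if h : x ∈ G.neighborFinset u then
      (e ⟨x, h⟩).castLE ((hΔ u).trans Δ.le_succ) else 0, fun x hx => ?_, fun x y hx hy h => ?_⟩
    · rw [← SimpleGraph.mem_neighborFinset] at hx
      simp only [hx, dif_pos]
      exact (e ⟨x, hx⟩).2.trans_le (hΔ u)
    · rw [← SimpleGraph.mem_neighborFinset] at hx hy
      simp only [hx, hy, dif_pos] at h
      simpa using e.injective (Fin.castLE_injective _ h)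
  choose port hlt hinj using hport
  have hcode : ∀ p ∈ walkSeqs G n, ∃ c : Fin n → Fin Δ, ∀ j : Fin n, (c j : ℕ) =
      (if i ≤ j.castSucc then port (p j.castSucc) (p j.succ)
      else port (p j.succ) (p j.castSucc) : Fin (Δ + 1)) := by
    intro p hp
    rw [mem_walkSeqs] at hp
    refine ⟨fun j => ⟨(if i ≤ j.castSucc then port (p j.castSucc) (p j.succ)
      else port (p j.succ) (p j.castSucc) : Fin (Δ + 1)), ?_⟩, fun j => rfl⟩
    split_ifs
    · exact hlt _ _ (hp j)
    · exact hlt _ _ (hp j).symm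
  choose code hcode using hcode
  suffices h : Function.Injective fun p : {p | p ∈ walkSeqs G n ∧ p i = v} => code p p.2.1 by
    rw [← Nat.card_coe_set_eq]
    exact (Nat.card_le_card_of_injective _ h).trans_eq (by simp)
  rintro ⟨p, hp, hpi⟩ ⟨q, hq, hqi⟩ hpq
  dsimp only at hpq
  have hc : ∀ j, (code p hp j : ℕ) = code q hq j := fun j => congrArg Fin.val (congrFun hpq j)
  have hp' := mem_walkSeqs.1 hp
  have hq' := mem_walkSeqs.1 hq
  have hup : ∀ j : Fin (n + 1), i ≤ j → p j = q j := by
    intro j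
    induction j using Fin.induction with
    | zero => intro h; rw [← Fin.le_zero_iff.1 h, hpi, hqi]
    | succ j ih =>
      intro h
      rcases h.eq_or_lt with h | h
      · rw [← h, hpi, hqi]
      have hj : i ≤ j.castSucc := Fin.le_castSucc_iff.2 h
      have := hc j
      rw [hcode p hp, hcode q hq, if_pos hj, if_pos hj, ih hj] at this
      exact hinj _ _ _ (ih hj ▸ hp' j) (hq' j) (Fin.ext this)
  have hdown : ∀ j : Fin (n + 1), j ≤ i → p j = q j := by
    intro j
    induction j using Fin.reverseInduction with
    | last => intro h; rw [← Fin.last_le_iff.1 h, hpi, hqi]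
    | cast j ih =>
      intro h
      rcases h.eq_or_lt with h | h
      · rw [h, hpi, hqi]
      have hj : j.succ ≤ i := Fin.castSucc_lt_iff_succ_le.1 h
      have := hc j
      rw [hcode p hp, hcode q hq, if_neg h.not_ge, if_neg h.not_ge, ih hj] at this
      exact hinj _ _ _ (ih hj ▸ (hp' j).symm) (hq' j).symm (Fin.ext this)
  refine Subtype.ext (funext fun j => ?_)
  exact (le_total i j).elim (hup j) (hdown j)

end Graph

theorem exists_three_pairs_of_card_image_lt {ℓ : ℕ} (c : ℕ → ℕ)
    (hc : ∀ i j, i < j → j < 2 * ℓ + 2 → c i = c j → ℓ + 1 ≤ j - i)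
    (hcard : ((Finset.range (2 * ℓ + 2)).image c).card < 2 * ℓ) :
    ∃ a b d e x y, [a, b, d, e, x, y].Nodup ∧ (∀ i ∈ [a, b, d, e, x, y], i < 2 * ℓ + 2) ∧
      c a = c b ∧ c d = c e ∧ c x = c y := by
  have hunion : Finset.range (2 * ℓ + 2) =
      Finset.range (ℓ + 1) ∪ Finset.Ico (ℓ + 1) (2 * ℓ + 2) := by
    ext i; simp; omega
  have h1 : ((Finset.range (ℓ + 1)).image c).card = ℓ + 1 := by
    rw [Finset.card_image_of_injOn, Finset.card_range]
    intro i hi j hj hij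
    simp only [Finset.coe_range, Set.mem_Iio] at hi hj
    by_contra hne
    rcases lt_or_gt_of_ne hne with h | h
    · have := hc i j h (by omega) hij; omega
    · have := hc j i h (by omega) hij.symm; omega
  have h2 : ((Finset.Ico (ℓ + 1) (2 * ℓ + 2)).image c).card = ℓ + 1 := by
    rw [Finset.card_image_of_injOn, Nat.card_Ico]
    · omega
    intro i hi j hj hij
    simp only [Finset.coe_Ico, Set.mem_Ico] at hi hj
    by_contra hne
    rcases lt_or_gt_of_ne hne with h | h
    · have := hc i j h (by omega) hij; omega
    · have := hc j i h (by omega) hij.symm; omega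
  have h3 := Finset.card_union_add_card_inter ((Finset.range (ℓ + 1)).image c)
    ((Finset.Ico (ℓ + 1) (2 * ℓ + 2)).image c)
  rw [← Finset.image_union, ← hunion, h1, h2] at h3
  obtain ⟨α, β, γ, hα, hβ, hγ, hαβ, hαγ, hβγ⟩ := Finset.two_lt_card_iff.1 (by omega :
    2 < ((Finset.range (ℓ + 1)).image c ∩ (Finset.Ico (ℓ + 1) (2 * ℓ + 2)).image c).card)
  simp only [Finset.mem_inter, Finset.mem_image, Finset.mem_range, Finset.mem_Ico] at hα hβ hγ
  obtain ⟨⟨a, ha, rfl⟩, b, hb, hab⟩ := hα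
  obtain ⟨⟨d, hd, rfl⟩, e, he, hde⟩ := hβ
  obtain ⟨⟨x, hx, rfl⟩, y, hy, hxy⟩ := hγ
  refine ⟨a, b, d, e, x, y, ?_, ?_, hab.symm, hde.symm, hxy.symm⟩
  · have had := ne_of_apply_ne c hαβ
    have hax := ne_of_apply_ne c hαγ
    have hdx := ne_of_apply_ne c hβγ
    have hbe : b ≠ e := ne_of_apply_ne c (by rwa [hab, hde])
    have hby : b ≠ y := ne_of_apply_ne c (by rwa [hab, hxy])
    have hey : e ≠ y := ne_of_apply_ne c (by rwa [hde, hxy])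
    simp only [List.nodup_cons, List.mem_cons, List.not_mem_nil, List.nodup_nil, or_false, not_or,
      not_false_eq_true, and_true]
    omega
  · simp only [List.mem_cons, List.not_mem_nil, or_false]
    omega

theorem IsGoodOn.isRAcyclicColoring {V : Type} [Fintype V] {G : SimpleGraph V} {ℓ : ℕ}
    (hℓ : 1 ≤ ℓ) {c : V → ℕ}
    (hc : IsGoodOn (puncturedBall G ℓ) (walkSeqs G (2 * ℓ + 1)) Finset.univ c) :
    IsRAcyclicColoring G (2 * ℓ) c := by
  classical
  have hnear : ∀ u v, u ≠ v → Near G ℓ u v → c u ≠ c v := fun u v huv h =>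
    hc.1 u (Finset.mem_univ u) v (Finset.mem_univ v) (mem_puncturedBall.2 ⟨huv.symm, h.symm⟩)
  refine ⟨fun u v h => hnear u v h.ne ⟨h.toWalk, by simpa using hℓ⟩, fun v w hw => ?_⟩
  have hinj : ∀ i j, i < j → j < w.length → w.getVert i ≠ w.getVert j := fun i j hij hj h =>
    hij.ne (hw.getVert_injOn' (by simp only [Set.mem_ofPred_eq]; omega)
      (by simp only [Set.mem_ofPred_eq]; omega) h)
  have hsupp : ∀ m, (Finset.range m).image (fun i => c (w.getVert i)) ⊆
      (w.support.map c).toFinset := by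
    intro m x hx
    obtain ⟨i, -, rfl⟩ := Finset.mem_image.1 hx
    exact List.mem_toFinset.2 (List.mem_map_of_mem (w.getVert_mem_support i))
  have hfar : ∀ i j, i < j → j < w.length → c (w.getVert i) = c (w.getVert j) → ℓ + 1 ≤ j - i := by
    intro i j hij hj h
    by_contra hlt
    have hn := near_getVert w i (j - i)
    rw [Nat.add_sub_cancel' hij.le] at hn
    exact hnear _ _ (hinj i j hij hj) (hn.mono (by omega)) h
  rcases le_or_gt w.length (2 * ℓ + 1) with hlen | hlen
  · refine (min_le_left _ _).trans ((Eq.ge ?_).trans (Finset.card_le_card (hsupp w.length)))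
    rw [Finset.card_image_of_injOn, Finset.card_range]
    have hne : ∀ i j, i < j → j < w.length → c (w.getVert i) ≠ c (w.getVert j) := by
      intro i j hij hj h
      have hd := hfar i j hij hj h
      have h1 := near_getVert w 0 i
      have h2 := near_getVert w j (w.length - j)
      rw [zero_add, w.getVert_zero] at h1
      rw [Nat.add_sub_cancel' hj.le, w.getVert_length] at h2
      exact hnear _ _ (hinj i j hij hj) ((h2.trans h1).symm.mono (by omega)) h
    intro i hi j hj h
    simp only [Finset.coe_range, Set.mem_Iio] at hi hj
    by_contra hij
    rcases lt_or_gt_of_ne hij with hij | hij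
    · exact hne i j hij hj h
    · exact hne j i hij hi h.symm
  · refine (min_le_right _ _).trans (le_trans ?_ (Finset.card_le_card (hsupp (2 * ℓ + 2))))
    by_contra! hlt
    obtain ⟨a, b, d, e, x, y, hnd, hmem, hab, hde, hxy⟩ := exists_three_pairs_of_card_image_lt
      (fun i => c (w.getVert i)) (fun i j hij hj h => hfar i j hij (by omega) h) hlt
    have hp : (fun i : Fin (2 * ℓ + 1 + 1) => w.getVert i) ∈ walkSeqs G (2 * ℓ + 1) :=
      mem_walkSeqs.2 fun i => w.adj_getVert_succ (by simp only [Fin.val_castSucc]; omega)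
    have hnd' : ([a, b, d, e, x, y].map w.getVert).Nodup := by
      refine List.Nodup.map_on (fun i hi j hj h => ?_) hnd
      have hi := hmem i hi
      have hj := hmem j hj
      by_contra hij
      rcases lt_or_gt_of_ne hij with hij | hij
      · exact hinj i j hij (by omega) h
      · exact hinj j i hij (by omega) h.symm
    simp only [List.forall_mem_cons] at hmem
    obtain ⟨ha, hb, hd, he, hx, hy, -⟩ := hmem
    exact hc.2 _ hp ⟨a, ha⟩ ⟨b, hb⟩ ⟨d, hd⟩ ⟨e, he⟩ ⟨x, hx⟩ ⟨y, hy⟩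
      ⟨hnd', fun _ _ => Finset.mem_univ _, hab, hde, hxy⟩

theorem stmt7 {V : Type} [Fintype V] (G : SimpleGraph V) [DecidableRel G.Adj]
    (Δ : ℕ) (hΔ : G.maxDegree = Δ) (h3 : 3 ≤ Δ)
    (ℓ : ℕ) (hℓ : 2 ≤ ℓ) (r : ℕ) (hr : r = 2 * ℓ) :
    rAcyclicChoiceNumber G r ≤
      ⌈(Δ : ℝ) ^ ℓ + (3 / 2) * ((r : ℝ) + 2) ^ 2 * (Δ : ℝ) ^ (((r : ℝ) + 1) / 3)⌉₊ := by
  subst hr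
  refine Nat.sInf_le fun L hL => ?_
  have hdeg : ∀ v, G.degree v ≤ Δ := fun v => hΔ ▸ G.degree_le_maxDegree v
  set t : ℝ := (Δ : ℝ) ^ ((((2 * ℓ : ℕ) : ℝ) + 1) / 3) with ht
  have hΔ0 : (0 : ℝ) < Δ := by exact_mod_cast (by omega : 0 < Δ)
  have ht0 : 0 < t := Real.rpow_pos_of_pos hΔ0 _
  have ht3 : t ^ 3 = (Δ : ℝ) ^ (2 * ℓ + 1) := by
    rw [ht, ← Real.rpow_natCast, ← Real.rpow_mul hΔ0.le, ← Real.rpow_natCast]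
    congr 1
    push_cast
    ring
  obtain ⟨c, hcL, hc⟩ := exists_isGoodOn_univ (n := 2 * ℓ + 1 + 1) (conf := puncturedBall G ℓ)
    (P := walkSeqs G (2 * ℓ + 1)) (D := Δ ^ ℓ) (M := Δ ^ (2 * ℓ + 1))
    (β := (((2 * ℓ : ℕ) : ℝ) + 2) ^ 2 * t) (by positivity) hL
    (fun u w h => by
      rw [mem_puncturedBall] at h ⊢
      exact ⟨h.1.symm, h.2.symm⟩)
    (fun u h => (mem_puncturedBall.1 h).1 rfl)
    (card_puncturedBall_le hdeg (by omega) (by omega))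
    (fun v i => ncard_walkSeqs_le hdeg i v) (by
      refine le_trans (le_of_eq ?_) (Nat.le_ceil _)
      push_cast
      rw [← ht3]
      have hne : (2 * (ℓ : ℝ) + 2) ≠ 0 := by positivity
      rw [show (2 * (ℓ : ℝ) + 1 + 1) = 2 * ℓ + 2 by ring]
      field_simp
      ring)
  exact ⟨c, hcL, hc.isRAcyclicColoring (by omega)⟩
end

section
/- Let m ≥ 2 be an integer and let F be a finite family of connected bipartite graphs each having at least m edges, and let k_e^m be the number of graphs in F having exactly m edges. Then for every ε > 0 there exists Δ_0 such that every graph G with maximum degree Δ ≥ Δ_0 admits a (2,F)-subgraph coloring with fewer than (k_e^m·(m+1) + e + ε)·Δ^(m/(m−1)) colors, where e is Euler's number; in particular χ_{2,F}(Δ) < (k_e^m + 1 + o(1))·(m+1)·Δ^(m/(m−1)). -/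
/-- A `(2,F)`-subgraph coloring (for a family `F = (H i)` of graphs): a proper vertex
coloring such that no copy of any `H i` (image of an injective graph homomorphism)
is colored with at most two colors, i.e. the union of any two color classes contains
no copy of any member of the family. -/
def Is2FColoring {V : Type} (G : SimpleGraph V) {ι : Type} {W : ι → Type}
    (H : ∀ i, SimpleGraph (W i)) {α : Type} (c : V → α) : Prop :=
  (∀ u v, G.Adj u v → c u ≠ c v) ∧
  ∀ (i : ι) (f : W i → V), Function.Injective f →
    (∀ x y, (H i).Adj x y → G.Adj (f x) (f y)) →
    ¬ ∃ a b : α, ∀ x, c (f x) = a ∨ c (f x) = b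

/-- The `(2,F)`-subgraph chromatic number of `G`. -/
noncomputable def chromatic2F {V : Type} (G : SimpleGraph V) {ι : Type} {W : ι → Type}
    (H : ∀ i, SimpleGraph (W i)) : ℕ :=
  sInf {k | ∃ c : V → Fin k, Is2FColoring G H c}

open Finset in
/-- A counting form of the local lemma. Every bad event `j` is determined by the colours outside a
set of `t j + 1` vertices, so the number of colourings avoiding all events inside a vertex set grows
by a factor of at least `β` with every vertex added to the set. -/
theorem exists_avoiding_coloring {V α J : Type*} [Fintype V] [DecidableEq V] [Fintype α]
    [Fintype J] (supp : J → Finset V) (bad : J → (V → α) → Prop) (t : J → ℕ) {β : ℝ}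
    (hβ : 0 < β) (hne : ∀ j, (supp j).Nonempty)
    (hdep : ∀ j c c', (∀ x ∈ supp j, c x = c' x) → bad j c → bad j c')
    (hdet : ∀ j, ∀ v ∈ supp j, ∃ T ⊆ supp j, v ∈ T ∧ #T = t j + 1 ∧
      ∀ c c', bad j c → bad j c' → (∀ x ∉ T, c x = c' x) → c = c')
    (hsum : ∀ v, β + ∑ j, (if v ∈ supp j then (β ^ t j)⁻¹ else 0) ≤ Fintype.card α) :
    ∃ c, ∀ j, ¬ bad j c := by
  classical
  rcases isEmpty_or_nonempty V with hV | ⟨⟨v₀⟩⟩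
  · exact ⟨fun v => hV.elim v, fun j => hV.elim (hne j).choose⟩
  have hα : Nonempty α := by
    by_contra h
    rw [not_nonempty_iff] at h
    have h1 := hsum v₀
    have h2 : 0 ≤ ∑ j, (if v₀ ∈ supp j then (β ^ t j)⁻¹ else 0) :=
      sum_nonneg fun j _ => by split_ifs <;> positivity
    rw [Fintype.card_eq_zero] at h1
    push_cast at h1
    linarith
  obtain ⟨d⟩ := hα
  let C : Finset V → Finset (V → α) := fun S =>
    univ.filter fun c => (∀ x ∉ S, c x = d) ∧ ∀ j, supp j ⊆ S → ¬ bad j c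
  have memC : ∀ S c, c ∈ C S ↔ (∀ x ∉ S, c x = d) ∧ ∀ j, supp j ⊆ S → ¬ bad j c :=
    fun S c => by simp [C]
  have step : ∀ S v, v ∉ S → (∀ U ⊆ S, β ^ #(S \ U) * #(C U) ≤ (#(C S) : ℝ)) →
      β * #(C S) ≤ (#(C (insert v S)) : ℝ) := by
    intro S v hv IH
    let E : Finset (V → α) := (C S ×ˢ univ).image fun p => Function.update p.1 v p.2
    have hE : #E = #(C S) * Fintype.card α := by
      rw [card_image_of_injOn, card_product, card_univ]
      rintro ⟨c, a⟩ hc ⟨c', a'⟩ hc' h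
      simp only [coe_product, Set.mem_prod, mem_coe, memC] at hc hc'
      simp only at h
      have ha : a = a' := by simpa using congrFun h v
      refine Prod.ext (funext fun x => ?_) ha
      by_cases hx : x = v
      · subst hx
        exact (hc.1.1 _ hv).trans (hc'.1.1 _ hv).symm
      · simpa [hx] using congrFun h x
    let B : J → Finset (V → α) := fun j =>
      if v ∈ supp j ∧ supp j ⊆ insert v S then E.filter (bad j) else ∅
    have hB : ∀ j, (#(B j) : ℝ) ≤ if v ∈ supp j then (β ^ t j)⁻¹ * #(C S) else 0 := by
      intro j
      by_cases hj : v ∈ supp j ∧ supp j ⊆ insert v S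
      · obtain ⟨T, hT, hvT, hTc, hTd⟩ := hdet j v hj.1
        simp only [B, if_pos hj, if_pos hj.1]
        have hcard : #(E.filter (bad j)) ≤ #(C (S \ T)) := by
          refine card_le_card_of_injOn (fun c x => if x ∈ T then d else c x) ?_ ?_
          · intro c hc
            simp only [E, coe_filter, mem_image, mem_product, mem_univ, and_true, Prod.exists,
              Set.mem_ofPred_eq] at hc
            obtain ⟨⟨c₀, a, hc₀, rfl⟩, -⟩ := hc
            rw [memC] at hc₀
            rw [mem_coe, memC]
            refine ⟨fun x hx => ?_, fun k hk hb => ?_⟩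
            · by_cases hxT : x ∈ T
              · simp [hxT]
              · have hxv : x ≠ v := fun h => hxT (h ▸ hvT)
                have hxS : x ∉ S := fun h => hx (mem_sdiff.2 ⟨h, hxT⟩)
                simp [hxT, hxv, hc₀.1 x hxS]
            · refine hc₀.2 k (hk.trans sdiff_subset) (hdep k _ _ (fun x hx => ?_) hb)
              have hxT := (mem_sdiff.1 (hk hx)).2
              have hxv : x ≠ v := fun h => hxT (h ▸ hvT)
              simp [hxT, hxv]
          · intro c hc c' hc' h
            simp only [coe_filter, Set.mem_ofPred_eq] at hc hc'
            refine hTd c c' hc.2 hc'.2 fun x hx => ?_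
            simpa [hx] using congrFun h x
        have hsd : #(S \ (S \ T)) = t j := by
          have : S \ (S \ T) = T.erase v := by
            ext x
            simp only [mem_sdiff, mem_erase]
            constructor
            · rintro ⟨h1, h2⟩
              exact ⟨fun h => hv (h ▸ h1), by tauto⟩
            · rintro ⟨h1, h2⟩
              exact ⟨(mem_insert.1 (hj.2 (hT h2))).resolve_left h1, by tauto⟩
          rw [this, card_erase_of_mem hvT, hTc, Nat.add_sub_cancel]
        have h1 := IH (S \ T) sdiff_subset
        rw [hsd] at h1
        have h2 : (#(E.filter (bad j)) : ℝ) ≤ #(C (S \ T)) := by exact_mod_cast hcard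
        rw [inv_mul_eq_div, le_div_iff₀ (by positivity)]
        calc _ ≤ (#(C (S \ T)) : ℝ) * β ^ t j := by gcongr
          _ ≤ _ := by rw [mul_comm]; exact h1
      · simp only [B, if_neg hj, card_empty, Nat.cast_zero]
        split_ifs <;> positivity
    have hsub : E ⊆ C (insert v S) ∪ univ.biUnion B := by
      intro c hc
      rw [mem_union, or_iff_not_imp_right]
      intro hcB
      have hc' := hc
      simp only [E, mem_image, mem_product, mem_univ, and_true, Prod.exists] at hc'
      obtain ⟨c₀, a, hc₀, rfl⟩ := hc'
      rw [memC] at hc₀ ⊢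
      refine ⟨fun x hx => ?_, fun k hk hb => ?_⟩
      · rw [mem_insert, not_or] at hx
        simp [hx.1, hc₀.1 x hx.2]
      · by_cases hvk : v ∈ supp k
        · refine hcB (mem_biUnion.2 ⟨k, mem_univ _, ?_⟩)
          simp only [B, if_pos (And.intro hvk hk), mem_filter]
          exact ⟨hc, hb⟩
        · refine hc₀.2 k (fun x hx => ?_) (hdep k _ _ (fun x hx => ?_) hb)
          · exact (mem_insert.1 (hk hx)).resolve_left fun h => hvk (h ▸ hx)
          · have hxv : x ≠ v := fun h => hvk (h ▸ hx)
            simp [hxv]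
    have hle : (#E : ℝ) ≤ #(C (insert v S)) + ∑ j, (#(B j) : ℝ) := by
      exact_mod_cast (card_le_card hsub).trans
        ((card_union_le _ _).trans (Nat.add_le_add_left card_biUnion_le _))
    have hle2 : ∑ j, (#(B j) : ℝ) ≤
        (∑ j, (if v ∈ supp j then (β ^ t j)⁻¹ else 0)) * #(C S) := by
      rw [sum_mul]
      refine sum_le_sum fun j _ => (hB j).trans (le_of_eq ?_)
      split_ifs <;> simp
    have h3 := mul_le_mul_of_nonneg_right (hsum v) (Nat.cast_nonneg (α := ℝ) #(C S))
    rw [hE] at hle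
    push_cast at hle
    linarith
  have grow : ∀ S, ∀ U ⊆ S, β ^ #(S \ U) * #(C U) ≤ (#(C S) : ℝ) := by
    intro S
    induction S using Finset.strongInduction with
    | H S IH =>
      intro U hU
      by_cases hSU : S \ U = ∅
      · have : U = S := hU.antisymm (sdiff_eq_empty_iff_subset.1 hSU)
        simp [this]
      · obtain ⟨w, hw⟩ := nonempty_iff_ne_empty.2 hSU
        obtain ⟨hwS, hwU⟩ := mem_sdiff.1 hw
        have hIH := IH (S.erase w) (erase_ssubset hwS)
        have h1 := step (S.erase w) w (notMem_erase w S) hIH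
        rw [insert_erase hwS] at h1
        have h2 := hIH U (subset_erase.2 ⟨hU, hwU⟩)
        have h3 : #(S \ U) = #(S.erase w \ U) + 1 := by
          rw [erase_sdiff_comm, card_erase_add_one hw]
        rw [h3, pow_succ]
        nlinarith
  have hC0 : (fun _ => d) ∈ C ∅ := by
    rw [memC]
    refine ⟨fun _ _ => rfl, fun j hj => ?_⟩
    exact absurd (subset_empty.1 hj) (hne j).ne_empty
  have hC0' : (0 : ℝ) < #(C ∅) := by exact_mod_cast card_pos.2 ⟨_, hC0⟩
  have hpos : (0 : ℝ) < #(C univ) :=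
    lt_of_lt_of_le (by positivity) (grow univ ∅ (empty_subset _))
  obtain ⟨c, hc⟩ := card_pos.1 (by exact_mod_cast hpos : 0 < #(C univ))
  exact ⟨c, fun j => ((memC _ _).1 hc).2 j (subset_univ _)⟩

namespace SimpleGraph

/-- In a connected graph with a proper `2`-colouring, every other proper colouring using at most two
colours is constant on the two sides. -/
theorem Connected.eq_of_coloring_eq {W α : Type*} {H : SimpleGraph W} (hH : H.Connected)
    (col : H.Coloring Bool) {g : W → α} (hg : ∀ x y, H.Adj x y → g x ≠ g y) {a b : α}
    (hab : ∀ x, g x = a ∨ g x = b) {w w' : W} (h : col w = col w') : g w = g w' := by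
  have key : ∀ u, H.Reachable w u → (g w = g u ↔ col w = col u) := by
    rintro u ⟨p⟩
    clear h
    induction p with
    | nil => simp
    | @cons u v w' huv p ih =>
      have h1 := hg _ _ huv
      have h2 := col.valid huv
      have h3 := hab u
      have h4 := hab v
      have h5 := hab w'
      have h6 : col u = !col v := by
        revert h2; cases col u <;> cases col v <;> simp
      have h7 : col u = col w' ↔ ¬ col v = col w' := by
        rw [h6]; cases col v <;> cases col w' <;> simp
      rw [h7, ← ih]
      constructor
      · intro h h'; exact h1 (h.trans h'.symm)
      · intro h
        rcases h3 with h3 | h3 <;> rcases h4 with h4 | h4 <;> rcases h5 with h5 | h5 <;>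
          simp_all
  exact (key w' (hH.preconnected w w')).2 h

open Finset in
/-- The number of maps `f` in `S` with `f w = v` that preserve adjacency is controlled by the number
of common neighbours of images of subsets of neighbourhoods. -/
theorem Connected.card_homs_mul_pow_le {V W : Type*} [Fintype V] [Fintype W]
    {G : SimpleGraph V} {H : SimpleGraph W} [DecidableRel G.Adj] [DecidableEq V]
    (hH : H.Connected) {D x : ℝ} (hD : 0 ≤ D) (hx : 1 ≤ x) (w : W) (v : V)
    (S : Finset (W → V)) (hw : ∀ f ∈ S, f w = v)
    (hadj : ∀ f ∈ S, ∀ a b, H.Adj a b → G.Adj (f a) (f b))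
    (hco : ∀ f ∈ S, ∀ u, ∀ B : Finset W, B.Nonempty → (∀ b ∈ B, H.Adj b u) →
      x ^ (#B - 1) * #{z | ∀ r ∈ B.image f, G.Adj r z} ≤ D) :
    #S * x ^ H.edgeSet.ncard ≤ (D * x) ^ (Fintype.card W - 1) := by
  classical
  have hx0 : 0 < x := by linarith
  let e : Finset W → ℕ := fun U => #{s ∈ H.edgeFinset | ∀ z ∈ s, z ∈ U}
  let ρ : Finset W → (W → V) → W → V := fun U f z => if z ∈ U then f z else v
  have key : ∀ k, k < Fintype.card W → ∃ U : Finset W, w ∈ U ∧ #U = k + 1 ∧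
      #(S.image (ρ U)) * x ^ e U ≤ (D * x) ^ k := by
    intro k
    induction k with
    | zero =>
      intro _
      refine ⟨{w}, mem_singleton_self w, card_singleton w, ?_⟩
      have he : e {w} = 0 := by
        rw [card_eq_zero, filter_eq_empty_iff]
        intro s
        induction s with
        | h a b =>
          intro hs h
          rw [mem_edgeFinset, mem_edgeSet] at hs
          have ha := h a (Sym2.mem_mk_left a b)
          have hb := h b (Sym2.mem_mk_right a b)
          rw [mem_singleton] at ha hb
          exact hs.ne (ha.trans hb.symm)
      have hc : #(S.image (ρ {w})) ≤ 1 := by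
        rw [card_le_one]
        simp only [mem_image]
        rintro _ ⟨f, hf, rfl⟩ _ ⟨g, hg, rfl⟩
        funext z
        by_cases hz : z = w
        · subst hz; simp [ρ, hw f hf, hw g hg]
        · simp [ρ, hz]
      rw [he]
      simpa using hc
    | succ k ih =>
      intro hk
      obtain ⟨U, hwU, hUc, hU⟩ := ih (by omega)
      obtain ⟨u, hu, b₀, hb₀, hub₀⟩ : ∃ u, u ∉ U ∧ ∃ b ∈ U, H.Adj b u := by
        obtain ⟨y, hy⟩ : ∃ y, y ∉ U := by
          by_contra! h
          have : U = univ := eq_univ_of_forall h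
          rw [this, card_univ] at hUc
          omega
        obtain ⟨p⟩ := hH.preconnected w y
        obtain ⟨d, -, hd1, hd2⟩ := p.exists_boundary_dart (U : Set W) hwU hy
        exact ⟨d.snd, hd2, d.fst, hd1, d.adj⟩
      let B : Finset W := {b ∈ U | H.Adj b u}
      have hBne : B.Nonempty := ⟨b₀, mem_filter.2 ⟨hb₀, hub₀⟩⟩
      have hBpos : 1 ≤ #B := card_pos.2 hBne
      refine ⟨insert u U, mem_insert_of_mem hwU, by rw [card_insert_of_notMem hu, hUc], ?_⟩
      have he : e (insert u U) ≤ e U + #B := by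
        have : ({s ∈ H.edgeFinset | ∀ z ∈ s, z ∈ insert u U} : Finset (Sym2 W)) ⊆
            {s ∈ H.edgeFinset | ∀ z ∈ s, z ∈ U} ∪ B.image (fun b => s(b, u)) := by
          intro s
          induction s with
          | h a b =>
            intro hs
            simp only [mem_filter, mem_edgeFinset, mem_edgeSet, Sym2.mem_iff, forall_eq_or_imp,
              forall_eq, mem_insert, mem_union, mem_image, B] at hs ⊢
            obtain ⟨hab, ha, hb⟩ := hs
            rcases ha with rfl | ha <;> rcases hb with rfl | hb
            · exact absurd rfl hab.ne
            · exact Or.inr ⟨b, ⟨hb, hab.symm⟩, Sym2.eq_swap⟩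
            · exact Or.inr ⟨a, ⟨ha, hab⟩, rfl⟩
            · exact Or.inl ⟨hab, ha, hb⟩
        exact (card_le_card this).trans ((card_union_le _ _).trans
          (Nat.add_le_add_left card_image_le _))
      have himg : (S.image (ρ (insert u U))).image (ρ U) = S.image (ρ U) := by
        rw [image_image]
        congr 1
        funext f z
        by_cases hz : z ∈ U <;> simp [ρ, hz]
      have hcard : #(S.image (ρ (insert u U))) ≤ ⌊D / x ^ (#B - 1)⌋₊ * #(S.image (ρ U)) := by
        rw [← himg]
        refine card_le_mul_card_image _ _ ?_
        rw [himg]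
        intro a ha
        obtain ⟨f₀, hf₀, rfl⟩ := mem_image.1 ha
        refine le_trans (b := #{z | ∀ r ∈ B.image f₀, G.Adj r z}) ?_ (Nat.le_floor ?_)
        · refine card_le_card_of_injOn (fun g => g u) ?_ ?_
          · intro g hg
            simp only [coe_filter, mem_image, Set.mem_ofPred_eq] at hg
            obtain ⟨⟨f, hf, rfl⟩, hfa⟩ := hg
            simp only [coe_filter, mem_univ, true_and, Set.mem_ofPred_eq, mem_image]
            rintro r ⟨b, hb, rfl⟩
            have hbU : b ∈ U := (mem_filter.1 hb).1
            have h1 := congrFun hfa b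
            simp only [ρ, hbU, mem_insert, or_true, if_true] at h1
            rw [← h1]
            simpa [ρ] using hadj f hf b u (mem_filter.1 hb).2
          · intro g hg g' hg' hgg
            simp only [coe_filter, mem_image, Set.mem_ofPred_eq] at hg hg'
            obtain ⟨⟨f, hf, rfl⟩, hfa⟩ := hg
            obtain ⟨⟨f', hf', rfl⟩, hfa'⟩ := hg'
            funext z
            by_cases hz : z ∈ U
            · have := congrFun (hfa.trans hfa'.symm) z
              simpa [ρ, hz] using this
            · by_cases hzu : z = u
              · subst hzu; exact hgg
              · simp [ρ, hz, hzu]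
        · rw [le_div_iff₀ (by positivity), mul_comm]
          exact hco f₀ hf₀ u B hBne fun b hb => (mem_filter.1 hb).2
      have hcard' : (#(S.image (ρ (insert u U))) : ℝ) ≤ D / x ^ (#B - 1) * #(S.image (ρ U)) := by
        have h1 : (#(S.image (ρ (insert u U))) : ℝ) ≤ ⌊D / x ^ (#B - 1)⌋₊ * #(S.image (ρ U)) := by
          exact_mod_cast hcard
        refine h1.trans ?_
        gcongr
        exact Nat.floor_le (by positivity)
      have hxB : x ^ #B = x ^ (#B - 1) * x := by
        rw [← pow_succ, Nat.sub_add_cancel hBpos]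
      calc (#(S.image (ρ (insert u U))) : ℝ) * x ^ e (insert u U)
          ≤ D / x ^ (#B - 1) * #(S.image (ρ U)) * x ^ (e U + #B) := by gcongr
        _ = #(S.image (ρ U)) * x ^ e U * (D * x) := by
            rw [pow_add, hxB]; field_simp
        _ ≤ (D * x) ^ k * (D * x) := by gcongr
        _ = (D * x) ^ (k + 1) := (pow_succ _ _).symm
  have hWpos : 0 < Fintype.card W := Fintype.card_pos_iff.2 ⟨w⟩
  obtain ⟨U, -, hUc, hU⟩ := key (Fintype.card W - 1) (by omega)
  have hUu : U = univ := by
    rw [← card_eq_iff_eq_univ]; omega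
  subst hUu
  have h1 : ρ univ = id := by
    funext f z; simp [ρ]
  have h2 : e univ = H.edgeSet.ncard := by
    simp only [e, mem_univ, implies_true, filter_true]
    rw [← coe_edgeFinset, Set.ncard_coe_finset]
  rwa [h1, image_id, h2] at hU

end SimpleGraph

open Finset in
/-- The form of `exists_avoiding_coloring` in which the colouring must not be constant on any set in
`R`, nor constant on both sides of any of the embedded bipartite patterns in `S i`. -/
theorem exists_coloring_not_constant {V α ι : Type*} {W : ι → Type*} [Fintype V] [DecidableEq V]
    [Fintype α] [Fintype ι] [∀ i, Fintype (W i)] (R : Finset (Finset V))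
    (hR : ∀ r ∈ R, 2 ≤ #r) (col : ∀ i, W i → Bool) (hcol : ∀ i, Function.Surjective (col i))
    (hW : ∀ i, 3 ≤ Fintype.card (W i)) (S : ∀ i, Finset (W i → V))
    (hS : ∀ i, ∀ f ∈ S i, Function.Injective f) {β : ℝ} (hβ : 0 < β)
    (hsum : ∀ v, β + (∑ r ∈ R with v ∈ r, (β ^ (#r - 2))⁻¹ +
      ∑ i, #{f ∈ S i | ∃ w, f w = v} * (β ^ (Fintype.card (W i) - 3))⁻¹) ≤ Fintype.card α) :
    ∃ c : V → α, (∀ r ∈ R, ∃ a ∈ r, ∃ b ∈ r, c a ≠ c b) ∧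
      ∀ i, ∀ f ∈ S i, ∃ w w', col i w = col i w' ∧ c (f w) ≠ c (f w') := by
  classical
  let supp : R ⊕ (Σ i, S i) → Finset V := Sum.elim (fun r => r.1)
    fun p => univ.filter fun v => ∃ w w', w ≠ w' ∧ col p.1 w = col p.1 w' ∧ p.2.1 w = v
  let bad : R ⊕ (Σ i, S i) → (V → α) → Prop := Sum.elim
    (fun r c => ∀ a ∈ r.1, ∀ b ∈ r.1, c a = c b)
    fun p c => ∀ w w', col p.1 w = col p.1 w' → c (p.2.1 w) = c (p.2.1 w')
  let t : R ⊕ (Σ i, S i) → ℕ := Sum.elim (fun r => #r.1 - 2) fun p => Fintype.card (W p.1) - 3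
  suffices h : ∃ c, ∀ j, ¬ bad j c by
    obtain ⟨c, hc⟩ := h
    refine ⟨c, fun r hr => ?_, fun i f hf => ?_⟩
    · have := hc (Sum.inl ⟨r, hr⟩)
      simpa [bad] using this
    · have := hc (Sum.inr ⟨i, ⟨f, hf⟩⟩)
      simpa [bad] using this
  refine exists_avoiding_coloring supp bad t hβ ?_ ?_ ?_ ?_
  · rintro (⟨r, hr⟩ | ⟨i, ⟨f, hf⟩⟩)
    · exact card_pos.1 (by have := hR r hr; simp only [supp, Sum.elim_inl]; omega)
    · obtain ⟨w, w', hne, h⟩ := Fintype.exists_ne_map_eq_of_card_lt (col i)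
        (by rw [Fintype.card_bool]; exact hW i)
      exact ⟨f w, mem_filter.2 ⟨mem_univ _, w, w', hne, h, rfl⟩⟩
  · rintro (⟨r, hr⟩ | ⟨i, ⟨f, hf⟩⟩) c c' hcc h
    · intro a ha b hb
      rw [← hcc a ha, ← hcc b hb]
      exact h a ha b hb
    · intro w w' hww
      by_cases hne : w = w'
      · rw [hne]
      · have h1 : f w ∈ supp (Sum.inr ⟨i, ⟨f, hf⟩⟩) :=
          mem_filter.2 ⟨mem_univ _, w, w', hne, hww, rfl⟩
        have h2 : f w' ∈ supp (Sum.inr ⟨i, ⟨f, hf⟩⟩) :=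
          mem_filter.2 ⟨mem_univ _, w', w, Ne.symm hne, hww.symm, rfl⟩
        exact (hcc _ h1).symm.trans ((h w w' hww).trans (hcc _ h2))
  · rintro (⟨r, hr⟩ | ⟨i, ⟨f, hf⟩⟩) v hv
    · have hv : v ∈ r := hv
      have h2 := hR r hr
      obtain ⟨a, ha⟩ : (r.erase v).Nonempty := card_pos.1 (by rw [card_erase_of_mem hv]; omega)
      obtain ⟨hav, har⟩ := mem_erase.1 ha
      refine ⟨r.erase a, erase_subset a r, mem_erase.2 ⟨hav.symm, hv⟩, ?_, ?_⟩
      · rw [card_erase_of_mem har]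
        simp only [t, Sum.elim_inl]
        omega
      · intro c c' h h' hcc
        have haa := hcc a (notMem_erase a r)
        funext x
        by_cases hx : x ∈ r
        · rw [h x hx a har, h' x hx a har, haa]
        · exact hcc x fun hx' => hx (mem_of_mem_erase hx')
    · simp only [supp, Sum.elim_inr, mem_filter, mem_univ, true_and] at hv
      obtain ⟨w, a, hwa, hcwa, rfl⟩ := hv
      obtain ⟨b, hb⟩ := hcol i (!col i w)
      have hba : b ≠ a := by
        rintro rfl
        rw [← hcwa] at hb
        simp at hb
      have hbw : b ≠ w := by
        rintro rfl
        simp at hb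
      refine ⟨((univ.erase a).erase b).image f, ?_, ?_, ?_, ?_⟩
      · intro x hx
        simp only [mem_image, mem_erase, mem_univ, and_true] at hx
        obtain ⟨y, ⟨hyb, hya⟩, rfl⟩ := hx
        simp only [supp, Sum.elim_inr, mem_filter, mem_univ, true_and]
        by_cases hy : col i y = col i w
        · exact ⟨y, a, hya, hy.trans hcwa, rfl⟩
        · refine ⟨y, b, hyb, ?_, rfl⟩
          rw [hb]
          revert hy
          cases col i y <;> cases col i w <;> simp
      · exact mem_image_of_mem f (by simp [hwa, hbw.symm])
      · rw [card_image_of_injective _ (hS i f hf), card_erase_of_mem (by simp [hba]),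
          card_erase_of_mem (mem_univ _), card_univ]
        have := hW i
        simp only [t, Sum.elim_inr]
        omega
      · intro c c' h h' hcc
        have hout : ∀ y, y = a ∨ y = b → c (f y) = c' (f y) := by
          intro y hy
          refine hcc _ fun hmem => ?_
          obtain ⟨z, hz, hzy⟩ := mem_image.1 hmem
          have := hS i f hf hzy
          subst this
          simp only [mem_erase, mem_univ, and_true] at hz
          tauto
        funext x
        by_cases hx : ∃ y, f y = x
        · obtain ⟨y, rfl⟩ := hx
          by_cases hy : col i y = col i w
          · rw [h y a (hy.trans hcwa), h' y a (hy.trans hcwa), hout a (Or.inl rfl)]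
          · have hyb : col i y = col i b := by
              rw [hb]
              revert hy
              cases col i y <;> cases col i w <;> simp
            rw [h y b hyb, h' y b hyb, hout b (Or.inr rfl)]
        · refine hcc x fun hmem => hx ?_
          obtain ⟨z, -, hz⟩ := mem_image.1 hmem
          exact ⟨z, hz⟩
  · intro v
    refine le_trans ?_ (hsum v)
    rw [Fintype.sum_sum_type, Fintype.sum_sigma]
    gcongr with i
    · rw [sum_filter, ← sum_coe_sort R]
      exact sum_le_sum fun r _ => le_rfl
    · simp only [supp, t, Sum.elim_inr]
      rw [← nsmul_eq_mul, ← sum_const, sum_filter, ← sum_coe_sort (S i)]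
      refine sum_le_sum fun f _ => ?_
      split_ifs with h1 h2
      · rfl
      · simp only [mem_filter, mem_univ, true_and] at h1
        obtain ⟨w, -, -, -, h⟩ := h1
        exact absurd ⟨w, h⟩ h2
      · positivity
      · rfl

namespace SimpleGraph

open Finset in
/-- A vertex `v` lies in at most `(D * x) ^ (k + 1) / (k + 1)!` sets of size `k + 2` with more than
`D / x ^ (k + 1)` common neighbours. -/
theorem card_sets_with_many_common_neighbors_mul_le {V : Type*} [Fintype V] [DecidableEq V]
    (G : SimpleGraph V) [DecidableRel G.Adj] {D : ℕ} (hD : 0 < D) (hG : ∀ v, G.degree v ≤ D)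
    {x : ℝ} (hx : 0 < x) (v : V) (k : ℕ) (R : Finset (Finset V))
    (hR : ∀ r ∈ R, v ∈ r ∧ #r = k + 1 ∧ (D : ℝ) < x ^ k * #{z | ∀ a ∈ r, G.Adj a z}) :
    (#R : ℝ) ≤ (D * x) ^ k / k.factorial := by
  have hD' : (0 : ℝ) < D := by exact_mod_cast hD
  let P : Finset (Σ _ : V, Finset V) :=
    (G.neighborFinset v).sigma fun z => (G.neighborFinset z).powersetCard k
  let Q : Finset (Σ _ : Finset V, V) := R.sigma fun r => {z | ∀ a ∈ r, G.Adj a z}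
  have hPQ : #Q ≤ #P := by
    refine card_le_card_of_injOn (fun q => ⟨q.2, q.1.erase v⟩) ?_ ?_
    · rintro ⟨r, z⟩ h
      simp only [Q, P, coe_sigma, Set.mem_sigma_iff, mem_coe, mem_filter, mem_univ, true_and,
        mem_neighborFinset, mem_powersetCard] at h ⊢
      obtain ⟨hr, hz⟩ := h
      obtain ⟨hv, hc, -⟩ := hR r hr
      refine ⟨hz v hv, fun a ha => ?_, ?_⟩
      · rw [mem_neighborFinset]
        exact (hz a (mem_of_mem_erase ha)).symm
      · rw [card_erase_of_mem hv, hc, Nat.add_sub_cancel]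
    · rintro ⟨r, z⟩ h ⟨r', z'⟩ h' he
      simp only [Q, coe_sigma, Set.mem_sigma_iff, mem_coe] at h h'
      simp only [Sigma.mk.injEq, heq_eq_eq] at he
      obtain ⟨rfl, he⟩ := he
      have : r = r' := by
        rw [← insert_erase (hR r h.1).1, he, insert_erase (hR r' h'.1).1]
      rw [this]
  have hP : (#P : ℝ) ≤ D * (D ^ k / k.factorial) := by
    rw [card_sigma, Nat.cast_sum]
    have : ∀ z ∈ G.neighborFinset v, ((#((G.neighborFinset z).powersetCard k) : ℕ) : ℝ) ≤
        D ^ k / k.factorial := by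
      intro z _
      rw [card_powersetCard, card_neighborFinset_eq_degree]
      refine (Nat.choose_le_pow_div k _).trans ?_
      gcongr
      exact hG z
    refine (sum_le_card_nsmul _ _ _ this).trans ?_
    rw [nsmul_eq_mul, card_neighborFinset_eq_degree]
    gcongr
    exact hG v
  have hQ : #R * (D : ℝ) ≤ x ^ k * #Q := by
    rw [card_sigma, Nat.cast_sum, mul_sum, ← nsmul_eq_mul]
    exact card_nsmul_le_sum _ _ _ fun r hr => (hR r hr).2.2.le
  have h1 : (#Q : ℝ) ≤ #P := by exact_mod_cast hPQ
  have h2 : #R * (D : ℝ) ≤ (D * x) ^ k / k.factorial * D :=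
    calc #R * (D : ℝ) ≤ x ^ k * #Q := hQ
      _ ≤ x ^ k * (D * (D ^ k / k.factorial)) := by gcongr; exact h1.trans hP
      _ = _ := by rw [mul_pow]; ring
  exact le_of_mul_le_mul_right h2 hD'

end SimpleGraph

open Finset in
theorem sum_range_inv_factorial_succ_le (n : ℕ) :
    ∑ k ∈ range n, ((k + 1).factorial : ℝ)⁻¹ ≤ Real.exp 1 - 1 := by
  have h := Real.sum_le_exp_of_nonneg (zero_le_one (α := ℝ)) (n + 1)
  rw [sum_range_succ'] at h
  simp only [one_pow, one_div, Nat.factorial_zero, Nat.cast_one, inv_one] at h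
  linarith

open Finset in
set_option maxHeartbeats 1000000 in
/-- With `D = x ^ (m - 1)`, a graph of maximum degree at most `D` has a `(2,F)`-subgraph colouring
with any number of colours exceeding `D * x` by the right constant factor. -/
theorem exists_is2FColoring {m : ℕ} (hm : 2 ≤ m) {ι : Type} [Fintype ι] {W : ι → Type}
    [∀ i, Fintype (W i)] {H : ∀ i, SimpleGraph (W i)} (hconn : ∀ i, (H i).Connected)
    (hbip : ∀ i, (H i).Colorable 2) (hedges : ∀ i, m ≤ (H i).edgeSet.ncard)
    {V : Type} [Fintype V] (G : SimpleGraph V) [DecidableRel G.Adj] {D : ℕ} (hD : 0 < D)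
    (hG : G.maxDegree ≤ D) {x : ℝ} (hx : 1 ≤ x) (hxD : x ^ (m - 1) = D) {N : ℕ}
    (hN : (D * x) * (#{i | (H i).edgeSet.ncard = m} * ((m : ℝ) + 1) + Real.exp 1) +
      D * (1 + ∑ i, (Fintype.card (W i) : ℝ)) ≤ N) :
    ∃ c : V → Fin N, Is2FColoring G H c := by
  classical
  have hx0 : 0 < x := by linarith
  have hD0 : (0 : ℝ) < D := by exact_mod_cast hD
  have hβ : 0 < D * x := by positivity
  have hdeg : ∀ v, G.degree v ≤ D := fun v => (G.degree_le_maxDegree v).trans hG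
  have hxm : D * x = x ^ m := by
    rw [← hxD, ← pow_succ]
    congr 1
    omega
  let col : ∀ i, (H i).Coloring Bool := fun i => (hbip i).toColoring (by simp)
  have hcol : ∀ i, Function.Surjective (col i) := by
    intro i
    obtain ⟨s, hs⟩ : (H i).edgeSet.Nonempty := by
      apply Set.nonempty_of_ncard_ne_zero
      have := hedges i
      omega
    induction s with
    | h a b =>
      have := (col i).valid hs
      intro y
      by_cases hy : col i a = y
      · exact ⟨a, hy⟩
      · refine ⟨b, ?_⟩
        revert this hy
        cases col i a <;> cases col i b <;> cases y <;> simp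
  have hWe : ∀ i, Fintype.card (W i) ≤ (H i).edgeSet.ncard + 1 := by
    intro i
    have := (hconn i).card_vert_le_card_edgeSet_add_one
    rwa [Nat.card_eq_fintype_card, Nat.card_coe_set_eq] at this
  have hW3 : ∀ i, 3 ≤ Fintype.card (W i) := by
    intro i
    by_contra! h
    have h1 := (H i).card_edgeFinset_le_card_choose_two
    have h2 := hedges i
    rw [← SimpleGraph.coe_edgeFinset, Set.ncard_coe_finset] at h2
    have h3 := Nat.choose_le_choose 2 (Nat.le_of_lt_succ h)
    simp only [Nat.choose_self] at h3
    omega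
  let special : Finset (Finset V) :=
    {r | 2 ≤ #r ∧ (D : ℝ) < x ^ (#r - 1) * #{z | ∀ a ∈ r, G.Adj a z}}
  let edges : Finset (Finset V) := {r | ∃ u v, G.Adj u v ∧ r = {u, v}}
  let S : ∀ i, Finset (W i → V) := fun i =>
    {f | Function.Injective f ∧ (∀ a b, (H i).Adj a b → G.Adj (f a) (f b)) ∧
      ∀ y, ∀ r ∈ special, ¬ r ⊆ ({w | col i w = y} : Finset (W i)).image f}
  have hSinj : ∀ i, ∀ f ∈ S i, Function.Injective f := fun i f hf => (mem_filter.1 hf).2.1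
  have hcopies : ∀ i v, (#{f ∈ S i | ∃ w, f w = v} : ℝ) * ((D * x) ^ (Fintype.card (W i) - 3))⁻¹ ≤
      (if (H i).edgeSet.ncard = m then D * x * ((m : ℝ) + 1) else 0) +
        D * Fintype.card (W i) := by
    intro i v
    have h1 : ∀ w, (#{f ∈ S i | f w = v} : ℝ) * x ^ (H i).edgeSet.ncard ≤
        (D * x) ^ (Fintype.card (W i) - 1) := by
      intro w
      refine (hconn i).card_homs_mul_pow_le (G := G) hD0.le hx w v _
        (fun f hf => (mem_filter.1 hf).2)
        (fun f hf => (mem_filter.1 (mem_filter.1 hf).1).2.2.1) ?_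
      intro f hf u B hB hBu
      obtain ⟨hfi, hfa, hfs⟩ := (mem_filter.1 (mem_filter.1 hf).1).2
      by_contra! hlt
      rcases Nat.lt_or_ge (#B) 2 with h2 | h2
      · obtain ⟨b, rfl⟩ := card_eq_one.1 (by have := card_pos.2 hB; omega : #B = 1)
        have h3 : #{z | ∀ r ∈ ({b} : Finset (W i)).image f, G.Adj r z} ≤ D := by
          refine le_trans (le_of_eq ?_) (hdeg (f b))
          rw [← SimpleGraph.card_neighborFinset_eq_degree]
          congr 1
          ext z
          simp
        have h4 : (#{z | ∀ r ∈ ({b} : Finset (W i)).image f, G.Adj r z} : ℝ) ≤ D := by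
          exact_mod_cast h3
        simp only [card_singleton, Nat.sub_self, pow_zero, one_mul] at hlt
        linarith
      · refine hfs (!col i u) (B.image f) ?_ ?_
        · simp only [special, mem_filter, mem_univ, true_and]
          rw [card_image_of_injective _ hfi]
          exact ⟨h2, hlt⟩
        · refine image_subset_image fun b hb => ?_
          have := (col i).valid (hBu b hb)
          simp only [mem_filter, mem_univ, true_and]
          revert this
          cases col i b <;> cases col i u <;> simp
    have h2 : (#{f ∈ S i | ∃ w, f w = v} : ℝ) ≤ ∑ w, (#{f ∈ S i | f w = v} : ℝ) := by
      have : ({f ∈ S i | ∃ w, f w = v} : Finset (W i → V)) ⊆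
          univ.biUnion fun w => {f ∈ S i | f w = v} := by
        intro f hf
        obtain ⟨hf, w, hw⟩ := mem_filter.1 hf
        exact mem_biUnion.2 ⟨w, mem_univ w, mem_filter.2 ⟨hf, hw⟩⟩
      exact_mod_cast (card_le_card this).trans card_biUnion_le
    have h3 : (#{f ∈ S i | ∃ w, f w = v} : ℝ) * x ^ (H i).edgeSet.ncard ≤
        Fintype.card (W i) * (D * x) ^ (Fintype.card (W i) - 1) := by
      refine (mul_le_mul_of_nonneg_right h2 (by positivity)).trans ?_
      rw [sum_mul]
      refine (sum_le_card_nsmul _ _ _ fun w _ => h1 w).trans ?_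
      rw [nsmul_eq_mul, card_univ]
    have h4 : (D * x) ^ (Fintype.card (W i) - 1) =
        (D * x) ^ (Fintype.card (W i) - 3) * (D * x) ^ 2 := by
      rw [← pow_add]
      congr 1
      have := hW3 i
      omega
    have h5 : (#{f ∈ S i | ∃ w, f w = v} : ℝ) * ((D * x) ^ (Fintype.card (W i) - 3))⁻¹ *
        x ^ (H i).edgeSet.ncard ≤ Fintype.card (W i) * (D * x) ^ 2 := by
      rw [h4] at h3
      rw [mul_right_comm, ← div_eq_mul_inv, div_le_iff₀ (by positivity)]
      linarith
    split_ifs with hm'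
    · rw [hm', ← hxm] at h5
      have h6 : (#{f ∈ S i | ∃ w, f w = v} : ℝ) * ((D * x) ^ (Fintype.card (W i) - 3))⁻¹ ≤
          Fintype.card (W i) * (D * x) :=
        le_of_mul_le_mul_right (by linarith) hβ
      have h7 : (Fintype.card (W i) : ℝ) ≤ m + 1 := by exact_mod_cast hm' ▸ hWe i
      have h8 : 0 ≤ D * (Fintype.card (W i) : ℝ) := by positivity
      nlinarith
    · have h6 : D * x * x ≤ x ^ (H i).edgeSet.ncard := by
        rw [hxm, ← pow_succ]
        exact pow_le_pow_right₀ hx (Nat.lt_of_le_of_ne (hedges i) (Ne.symm hm'))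
      rw [zero_add]
      refine le_of_mul_le_mul_right ?_ (by positivity : 0 < D * x * x)
      calc _ ≤ _ := mul_le_mul_of_nonneg_left h6 (by positivity)
        _ ≤ _ := h5
        _ = _ := by ring
  have hedge : ∀ v, ∑ r ∈ edges with v ∈ r, ((D * x) ^ (#r - 2))⁻¹ ≤ (D : ℝ) := by
    intro v
    have hsub : ({r ∈ edges | v ∈ r} : Finset (Finset V)) ⊆
        (G.neighborFinset v).image fun u => {v, u} := by
      intro r hr
      simp only [edges, mem_filter, mem_univ, true_and] at hr
      obtain ⟨⟨a, b, hab, rfl⟩, hv⟩ := hr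
      simp only [mem_image, SimpleGraph.mem_neighborFinset]
      rcases mem_insert.1 hv with rfl | hv
      · exact ⟨b, hab, rfl⟩
      · rw [mem_singleton] at hv
        subst hv
        exact ⟨a, hab.symm, pair_comm _ _⟩
    have h1 : #{r ∈ edges | v ∈ r} ≤ D :=
      (card_le_card hsub).trans (card_image_le.trans
        (by rw [SimpleGraph.card_neighborFinset_eq_degree]; exact hdeg v))
    have h2 : ∀ r ∈ ({r ∈ edges | v ∈ r} : Finset (Finset V)), ((D * x) ^ (#r - 2))⁻¹ ≤ 1 := by
      intro r hr
      obtain ⟨a, b, hab, rfl⟩ := (mem_filter.1 (mem_filter.1 hr).1).2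
      rw [card_pair hab.ne]
      simp
    refine (sum_le_card_nsmul _ _ _ h2).trans ?_
    rw [nsmul_eq_mul, mul_one]
    exact_mod_cast h1
  have hspecial : ∀ v, ∑ r ∈ special with v ∈ r, ((D * x) ^ (#r - 2))⁻¹ ≤
      (D * x) * (Real.exp 1 - 1) := by
    intro v
    rw [← sum_fiberwise_of_maps_to (t := range (Fintype.card V + 1)) (g := fun r => #r - 2)
      (fun r _ => mem_range.2 (by have := card_le_univ r; omega))]
    refine le_trans ?_ (mul_le_mul_of_nonneg_left
      (sum_range_inv_factorial_succ_le (Fintype.card V + 1)) hβ.le)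
    rw [mul_sum]
    refine sum_le_sum fun k _ => ?_
    have h1 := G.card_sets_with_many_common_neighbors_mul_le hD hdeg hx0 v (k + 1)
      ({r ∈ ({r ∈ special | v ∈ r} : Finset (Finset V)) | #r - 2 = k}) (by
        intro r hr
        simp only [special, mem_filter, mem_univ, true_and] at hr
        obtain ⟨⟨⟨h2, hlt⟩, hv⟩, hk⟩ := hr
        have h3 : #r - 1 = k + 1 := by omega
        rw [h3] at hlt
        exact ⟨hv, by omega, hlt⟩)
    have h2 : ∀ r ∈ ({r ∈ ({r ∈ special | v ∈ r} : Finset (Finset V)) | #r - 2 = k}),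
        ((D * x) ^ (#r - 2))⁻¹ ≤ ((D * x) ^ k)⁻¹ := fun r hr => by rw [(mem_filter.1 hr).2]
    refine (sum_le_card_nsmul _ _ _ h2).trans ?_
    rw [nsmul_eq_mul]
    refine (mul_le_mul_of_nonneg_right h1 (by positivity)).trans (le_of_eq ?_)
    rw [pow_succ]
    field_simp
  suffices hc : ∃ c : V → Fin N, (∀ r ∈ special ∪ edges, ∃ a ∈ r, ∃ b ∈ r, c a ≠ c b) ∧
      ∀ i, ∀ f ∈ S i, ∃ w w', col i w = col i w' ∧ c (f w) ≠ c (f w') by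
    obtain ⟨c, hc1, hc2⟩ := hc
    have hproper : ∀ u v, G.Adj u v → c u ≠ c v := by
      intro u v huv h
      obtain ⟨a, ha, b, hb, hab⟩ := hc1 {u, v}
        (mem_union_right _ (mem_filter.2 ⟨mem_univ _, u, v, huv, rfl⟩))
      simp only [mem_insert, mem_singleton] at ha hb
      rcases ha with rfl | rfl <;> rcases hb with rfl | rfl
      exacts [hab rfl, hab h, hab h.symm, hab rfl]
    refine ⟨c, hproper, ?_⟩
    rintro i f hfi hfa ⟨a, b, hab⟩
    have hconst : ∀ w w', col i w = col i w' → c (f w) = c (f w') := fun w w' h =>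
      (hconn i).eq_of_coloring_eq (col i) (g := fun w => c (f w))
        (fun x y hxy => hproper _ _ (hfa x y hxy)) hab h
    by_cases hf : f ∈ S i
    · obtain ⟨w, w', h, hne⟩ := hc2 i f hf
      exact hne (hconst w w' h)
    · simp only [S, mem_filter, mem_univ, true_and, not_and, not_forall, not_not] at hf
      obtain ⟨y, r, hr, hsub⟩ := hf hfi hfa
      obtain ⟨a, ha, b, hb, hne⟩ := hc1 r (mem_union_left _ hr)
      obtain ⟨w, hw, rfl⟩ := mem_image.1 (hsub ha)
      obtain ⟨w', hw', rfl⟩ := mem_image.1 (hsub hb)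
      exact hne (hconst w w' ((mem_filter.1 hw).2.trans (mem_filter.1 hw').2.symm))
  refine exists_coloring_not_constant (special ∪ edges) ?_ (fun i => col i) hcol hW3 S hSinj hβ ?_
  · intro r hr
    rcases mem_union.1 hr with hr | hr
    · exact (mem_filter.1 hr).2.1
    · obtain ⟨a, b, hab, rfl⟩ := (mem_filter.1 hr).2
      rw [card_pair hab.ne]
  · intro v
    rw [Fintype.card_fin]
    refine le_trans ?_ hN
    have h1 : ∑ r ∈ special ∪ edges with v ∈ r, ((D * x) ^ (#r - 2))⁻¹ ≤
        (D * x) * (Real.exp 1 - 1) + D := by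
      refine le_trans ?_ (add_le_add (hspecial v) (hedge v))
      rw [filter_union, ← sum_union_inter]
      exact le_add_of_nonneg_right (sum_nonneg fun r _ => by positivity)
    have h2 := sum_le_sum fun i (_ : i ∈ univ) => hcopies i v
    rw [sum_add_distrib, ← sum_filter, sum_const, nsmul_eq_mul, ← mul_sum] at h2
    linarith

theorem stmt10 (m : ℕ) (hm : 2 ≤ m)
    (ι : Type) [Fintype ι] (W : ι → Type) [∀ i, Fintype (W i)]
    (H : ∀ i, SimpleGraph (W i))
    (hconn : ∀ i, (H i).Connected) (hbip : ∀ i, (H i).Colorable 2)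
    (hedges : ∀ i, m ≤ (H i).edgeSet.ncard) :
    ∀ ε : ℝ, 0 < ε → ∃ Δ₀ : ℕ, ∀ Δ : ℕ, Δ₀ ≤ Δ →
      ∀ (V : Type) [Fintype V] (G : SimpleGraph V) [DecidableRel G.Adj],
        G.maxDegree ≤ Δ →
        (chromatic2F G H : ℝ) <
          (((Finset.univ.filter fun i => (H i).edgeSet.ncard = m).card : ℝ) * ((m : ℝ) + 1)
              + Real.exp 1 + ε)
            * (Δ : ℝ) ^ ((m : ℝ) / ((m : ℝ) - 1)) := by
  intro ε hε
  have hm1 : (0 : ℝ) < (m : ℝ) - 1 := by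
    have : (2 : ℝ) ≤ m := by exact_mod_cast hm
    linarith
  have hlim := ((tendsto_rpow_atTop (inv_pos.2 hm1)).comp
    tendsto_natCast_atTop_atTop).eventually_ge_atTop
    ((2 + ∑ i, (Fintype.card (W i) : ℝ)) / ε)
  obtain ⟨Δ₀, hΔ₀⟩ := Filter.eventually_atTop.1 (hlim.and (Filter.eventually_ge_atTop 1))
  refine ⟨Δ₀, fun Δ hΔ V _ G _ hG => ?_⟩
  obtain ⟨hx, hΔ1⟩ := hΔ₀ Δ hΔ
  simp only [Function.comp_apply] at hx
  have hD1 : (1 : ℝ) ≤ Δ := by exact_mod_cast hΔ1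
  set x : ℝ := (Δ : ℝ) ^ ((m : ℝ) - 1)⁻¹ with hxdef
  have hx1 : 1 ≤ x := Real.one_le_rpow hD1 (inv_pos.2 hm1).le
  have hxD : x ^ (m - 1) = Δ := by
    rw [hxdef, ← Real.rpow_natCast, ← Real.rpow_mul (by positivity), Nat.cast_sub (by omega),
      Nat.cast_one, inv_mul_cancel₀ hm1.ne', Real.rpow_one]
  have hβ : (Δ : ℝ) ^ ((m : ℝ) / ((m : ℝ) - 1)) = Δ * x := by
    have : (m : ℝ) / ((m : ℝ) - 1) = 1 + ((m : ℝ) - 1)⁻¹ := by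
      field_simp
      ring
    rw [this, Real.rpow_add (by linarith), Real.rpow_one]
  have hcard := exists_is2FColoring hm hconn hbip hedges G hΔ1 hG hx1 hxD (Nat.le_ceil _)
  refine lt_of_le_of_lt (Nat.cast_le.2 (Nat.sInf_le hcard)) ?_
  refine (Nat.ceil_lt_add_one (by positivity)).trans_le ?_
  rw [hβ]
  rw [div_le_iff₀ hε] at hx
  have h1 := mul_le_mul_of_nonneg_left hx (by linarith : (0 : ℝ) ≤ Δ)
  linarith
end

section
/- Let α > 0, let G be a graph with maximum degree Δ equipped with a total order ≺ on its vertices, and for a vertex u let S(u) be the set of vertices v at distance 2 from u such that (u,v) is special (i.e., fewer than α·Δ^(4/3) vertices w at distance 2 from u satisfy v ≺_u w). Then for any vertex v of G, the number of induced 4-cycles (v, x, u, y) of G passing through v whose vertex u opposite to v does not belong to S(v) is at most Δ^(8/3)/(8α). -/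
/-- `v` is at distance exactly 2 from `u`. -/
def DistTwo {V : Type} (G : SimpleGraph V) (u v : V) : Prop :=
  u ≠ v ∧ ¬ G.Adj u v ∧ ∃ w, G.Adj u w ∧ G.Adj w v

/-- `deg(u,v)`: the number of common neighbors of `u` and `v`. -/
noncomputable def codeg {V : Type} (G : SimpleGraph V) (u v : V) : ℕ :=
  (G.neighborSet u ∩ G.neighborSet v).ncard

/-- The order `≺_u` on the second neighborhood of `u`:
`v ≺_u w` iff `deg(u,v) < deg(u,w)`, or `deg(u,v) = deg(u,w)` and `v ≺ w`. -/
def OrdU {V : Type} [LinearOrder V] (G : SimpleGraph V) (u v w : V) : Prop :=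
  codeg G u v < codeg G u w ∨ (codeg G u v = codeg G u w ∧ v < w)

/-- The couple `(u, v)` is special (for the parameter `α` and maximum degree `Δ`):
`v ∈ N²(u)` and fewer than `α · Δ^(4/3)` vertices `w ∈ N²(u)` satisfy `v ≺_u w`. -/
def IsSpecialPair {V : Type} [LinearOrder V] (G : SimpleGraph V) (α : ℝ) (Δ : ℕ)
    (u v : V) : Prop :=
  DistTwo G u v ∧
    (({w | DistTwo G u w ∧ OrdU G u v w}.ncard : ℝ) < α * (Δ : ℝ) ^ ((4 : ℝ) / 3))

theorem codeg_eq_card {V : Type} [Fintype V] [DecidableEq V] (G : SimpleGraph V)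
    [DecidableRel G.Adj] (u v : V) :
    codeg G u v = (G.neighborFinset u ∩ G.neighborFinset v).card := by
  rw [codeg, ← Set.ncard_coe_finset]
  congr 1
  ext w
  simp

/-- Double counting the paths of length two starting at `v`. -/
theorem sum_codeg_le {V : Type} [Fintype V] (G : SimpleGraph V)
    [DecidableRel G.Adj] (v : V) : ∑ u, codeg G v u ≤ G.maxDegree ^ 2 := by
  classical
  have h : ∀ u, codeg G v u = ∑ w ∈ G.neighborFinset v, if G.Adj w u then 1 else 0 := by
    intro u
    rw [codeg_eq_card, Finset.sum_boole, Nat.cast_id]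
    congr 1
    ext w
    simp [G.adj_comm]
  calc ∑ u, codeg G v u
      = ∑ w ∈ G.neighborFinset v, ∑ u, if G.Adj w u then 1 else 0 := by
        simp_rw [h]
        exact Finset.sum_comm
    _ = ∑ w ∈ G.neighborFinset v, G.degree w := by
        refine Finset.sum_congr rfl fun w _ => ?_
        rw [Finset.sum_boole, Nat.cast_id, ← G.card_neighborFinset_eq_degree]
        congr 1
        ext u
        simp
    _ ≤ ∑ w ∈ G.neighborFinset v, G.maxDegree :=
        Finset.sum_le_sum fun w _ => G.degree_le_maxDegree w
    _ ≤ G.maxDegree ^ 2 := by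
        rw [Finset.sum_const, smul_eq_mul, G.card_neighborFinset_eq_degree, sq]
        exact Nat.mul_le_mul_right _ (G.degree_le_maxDegree v)

theorem two_mul_card_filter_lt_le_s12 {V : Type} [LinearOrder V] (C : Finset V) :
    2 * ((C ×ˢ C).filter fun p => p.1 < p.2).card ≤ C.card ^ 2 := by
  have hswap : ((C ×ˢ C).filter fun p => p.1 < p.2).card =
      ((C ×ˢ C).filter fun p => p.2 < p.1).card := by
    refine Finset.card_bij' (fun p _ => p.swap) (fun p _ => p.swap) ?_ ?_ ?_ ?_ <;>
      simp +contextual [and_comm]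
  have hdisj : Disjoint ((C ×ˢ C).filter fun p => p.1 < p.2)
      ((C ×ˢ C).filter fun p => p.2 < p.1) :=
    Finset.disjoint_filter.2 fun p _ h => h.le.not_gt
  rw [two_mul]
  nth_rewrite 2 [hswap]
  rw [← Finset.card_union_of_disjoint hdisj, sq, ← Finset.card_product]
  exact Finset.card_le_card
    (Finset.union_subset (Finset.filter_subset _ _) (Finset.filter_subset _ _))

/-- The 4-cycles through `v` with opposite vertex in `A`, counted by common neighbors. -/
theorem two_mul_card_cycles_le {V : Type} [Fintype V] [LinearOrder V] (G : SimpleGraph V)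
    (v : V) (A : Finset V) (Q : Finset (V × V × V))
    (hQ : ∀ q ∈ Q, q.2.1 ∈ A ∧ G.Adj v q.1 ∧ G.Adj q.1 q.2.1 ∧ G.Adj q.2.1 q.2.2 ∧
      G.Adj q.2.2 v ∧ q.1 < q.2.2) :
    2 * Q.card ≤ ∑ u ∈ A, codeg G v u ^ 2 := by
  classical
  rw [Finset.card_eq_sum_card_fiberwise (f := fun q : V × V × V => q.2.1) (t := A)
    (fun q hq => (hQ q hq).1), Finset.mul_sum]
  refine Finset.sum_le_sum fun u _ => ?_
  rw [codeg_eq_card]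
  refine le_trans (Nat.mul_le_mul_left 2 ?_) (two_mul_card_filter_lt_le_s12 _)
  refine Finset.card_le_card_of_injOn (fun q => (q.1, q.2.2)) ?_ ?_
  · intro q hq
    obtain ⟨hqQ, rfl⟩ := Finset.mem_filter.1 hq
    obtain ⟨-, h1, h2, h3, h4, h5⟩ := hQ q hqQ
    simp [h1, h2.symm, h3, h4.symm, h5]
  · rintro ⟨a, b, c⟩ hq ⟨a', b', c'⟩ hq' h
    have hb := (Finset.mem_filter.1 hq).2
    have hb' := (Finset.mem_filter.1 hq').2
    simp_all

/-- Among the vertices at distance two that are not special for `v`, one has maximal codegree `m`;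
at least `α Δ^(4/3)` special vertices have codegree at least `m`. -/
theorem sum_codeg_sq_le {V : Type} [Fintype V] [LinearOrder V] (G : SimpleGraph V)
    [DecidableRel G.Adj] (α : ℝ) (Δ : ℕ) (v : V)
    (A : Finset V) (hA : ∀ u, u ∈ A ↔ DistTwo G v u ∧ ¬ IsSpecialPair G α Δ v u)
    (hne : A.Nonempty) :
    ∃ m : ℝ, ((∑ u ∈ A, codeg G v u ^ 2 : ℕ) : ℝ) ≤
      m * ((G.maxDegree : ℝ) ^ 2 - α * (Δ : ℝ) ^ ((4 : ℝ) / 3) * m) := by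
  classical
  obtain ⟨t, htA, ht⟩ := Finset.exists_max_image A (fun u => toLex (codeg G v u, u)) hne
  have hle : ∀ u ∈ A, codeg G v u ≤ codeg G v t := by
    intro u hu
    have := ht u hu
    rw [Prod.Lex.toLex_le_toLex] at this
    rcases this with h | h
    · exact h.le
    · exact h.1.le
  set B : Finset V := Finset.univ.filter fun w => DistTwo G v w ∧ OrdU G v t w with hB
  have hBt : α * (Δ : ℝ) ^ ((4 : ℝ) / 3) ≤ B.card := by
    obtain ⟨h1, h2⟩ := (hA t).1 htA
    have h3 := not_lt.1 fun h => h2 ⟨h1, h⟩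
    rwa [← Set.ncard_coe_finset, hB, Finset.coe_filter_univ]
  have hdisj : Disjoint A B := by
    refine Finset.disjoint_left.2 fun u hu huB => ?_
    have h1 := ht u hu
    refine h1.not_gt ?_
    rw [Prod.Lex.toLex_lt_toLex]
    exact (Finset.mem_filter.1 huB).2.2
  have hBge : B.card * codeg G v t ≤ ∑ w ∈ B, codeg G v w := by
    rw [← smul_eq_mul]
    refine Finset.card_nsmul_le_sum _ _ _ fun w hw => ?_
    rcases (Finset.mem_filter.1 hw).2.2 with h | h
    · exact h.le
    · exact h.1.le
  have htotal : ∑ u ∈ A, codeg G v u + B.card * codeg G v t ≤ G.maxDegree ^ 2 :=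
    calc _ ≤ ∑ u ∈ A, codeg G v u + ∑ w ∈ B, codeg G v w := by gcongr
      _ = ∑ u ∈ A ∪ B, codeg G v u := (Finset.sum_union hdisj).symm
      _ ≤ ∑ u, codeg G v u := Finset.sum_le_sum_of_subset (Finset.subset_univ _)
      _ ≤ _ := sum_codeg_le G v
  have hsq : ∑ u ∈ A, codeg G v u ^ 2 ≤ codeg G v t * ∑ u ∈ A, codeg G v u := by
    rw [Finset.mul_sum]
    refine Finset.sum_le_sum fun u hu => ?_
    rw [sq]
    exact Nat.mul_le_mul_right _ (hle u hu)
  have hm : (0 : ℝ) ≤ codeg G v t := Nat.cast_nonneg _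
  refine ⟨codeg G v t, (Nat.cast_le.2 hsq).trans ?_⟩
  have htotal' : ((∑ u ∈ A, codeg G v u : ℕ) : ℝ) + B.card * codeg G v t ≤
      (G.maxDegree : ℝ) ^ 2 := by exact_mod_cast htotal
  rw [Nat.cast_mul]
  refine mul_le_mul_of_nonneg_left ?_ hm
  linarith [mul_le_mul_of_nonneg_right hBt hm]

theorem stmt12 {V : Type} [Fintype V] [LinearOrder V] (G : SimpleGraph V)
    [DecidableRel G.Adj] (α : ℝ) (hα : 0 < α) (Δ : ℕ) (hΔ : G.maxDegree = Δ) (v : V) :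
    ({q : V × V × V |
        q.1 ≠ q.2.2 ∧ q.1 ≠ v ∧ q.2.2 ≠ v ∧ q.2.1 ≠ v ∧ q.2.1 ≠ q.1 ∧ q.2.1 ≠ q.2.2 ∧
        G.Adj v q.1 ∧ G.Adj q.1 q.2.1 ∧ G.Adj q.2.1 q.2.2 ∧ G.Adj q.2.2 v ∧
        ¬ G.Adj v q.2.1 ∧ ¬ G.Adj q.1 q.2.2 ∧
        ¬ IsSpecialPair G α Δ v q.2.1 ∧ q.1 < q.2.2}.ncard : ℝ) ≤
      (Δ : ℝ) ^ ((8 : ℝ) / 3) / (8 * α) := by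
  classical
  set S : Set (V × V × V) := {q | _} with hS
  set Q : Finset (V × V × V) := S.toFinset with hQ
  rw [Set.ncard_eq_toFinset_card', ← hQ]
  rcases Q.eq_empty_or_nonempty with hemp | hne
  · rw [hemp, Finset.card_empty, Nat.cast_zero]
    positivity
  set A : Finset V :=
    Finset.univ.filter fun u => DistTwo G v u ∧ ¬ IsSpecialPair G α Δ v u with hA
  have hmem : ∀ q ∈ Q, q.2.1 ∈ A ∧ G.Adj v q.1 ∧ G.Adj q.1 q.2.1 ∧ G.Adj q.2.1 q.2.2 ∧
      G.Adj q.2.2 v ∧ q.1 < q.2.2 := by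
    intro q hq
    obtain ⟨-, -, -, hne, -, -, h1, h2, h3, h4, h5, -, h6, h7⟩ := Set.mem_toFinset.1 hq
    exact ⟨Finset.mem_filter.2 ⟨Finset.mem_univ _, ⟨hne.symm, h5, _, h1, h2⟩, h6⟩,
      h1, h2, h3, h4, h7⟩
  obtain ⟨q, hq⟩ := hne
  have hpos : 0 < Δ := by
    rw [← hΔ]
    refine lt_of_lt_of_le ?_ (G.degree_le_maxDegree v)
    exact (G.degree_pos_iff_exists_adj v).2 ⟨_, (hmem q hq).2.1⟩
  have hΔ0 : (0 : ℝ) < Δ := Nat.cast_pos.2 hpos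
  obtain ⟨m, hm⟩ := sum_codeg_sq_le G α Δ v A (by simp [hA]) ⟨_, (hmem q hq).1⟩
  have hcount : 2 * (Q.card : ℝ) ≤ ((∑ u ∈ A, codeg G v u ^ 2 : ℕ) : ℝ) := by
    exact_mod_cast two_mul_card_cycles_le G v A Q hmem
  rw [hΔ] at hm
  have hpow : (Δ : ℝ) ^ ((8 : ℝ) / 3) * (Δ : ℝ) ^ ((4 : ℝ) / 3) = ((Δ : ℝ) ^ 2) ^ 2 := by
    rw [← Real.rpow_add hΔ0, ← pow_mul, ← Real.rpow_natCast]
    norm_num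
  have hr : 0 < (Δ : ℝ) ^ ((4 : ℝ) / 3) := Real.rpow_pos_of_pos hΔ0 _
  rw [le_div_iff₀ (by positivity)]
  refine le_of_mul_le_mul_right ?_ hr
  rw [hpow]
  have hT := mul_le_mul_of_nonneg_left (hcount.trans hm)
    (mul_pos hα hr).le
  linarith [sq_nonneg ((Δ : ℝ) ^ 2 - 2 * (α * (Δ : ℝ) ^ ((4 : ℝ) / 3) * m))]
end

section
/- Let m ≥ 2 be an integer, γ = m/(m−1), and let G be a graph with maximum degree Δ. Let H be a connected bipartite graph with parts V_1 and V_2, with n_H ≥ 3 vertices and m_H ≥ m edges. Then every vertex v of G belongs to at most n_H·Δ^(γ(n_H − 2) − (m_H − m)/(m−1)) copies of H in G (subgraphs of G isomorphic to H) in which no subset of the image of V_1 and no subset of the image of V_2 is a special set. -/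
/-- A finite set `S` of vertices is special (for the parameters `m` and `Δ`) if
`|S| = j ≥ 2` and the common neighborhood of `S` has more than `Δ^(j − γ(j−1))`
elements, where `γ = m/(m−1)`. -/
def IsSpecialSet {V : Type} (G : SimpleGraph V) (m Δ : ℕ) (S : Finset V) : Prop :=
  2 ≤ S.card ∧
    (Δ : ℝ) ^ ((S.card : ℝ) - ((m : ℝ) / ((m : ℝ) - 1)) * ((S.card : ℝ) - 1)) <
      ({w : V | ∀ u ∈ S, G.Adj u w}.ncard : ℝ)

open Classical in
/-- Keep the values of `f` on `A` and replace all the others by the default value `v`. -/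
noncomputable def restrictTo {V W : Type} (v : V) (A : Finset W) (f : W → V) : W → V :=
  fun w => if w ∈ A then f w else v

lemma restrictTo_restrictTo {V W : Type} (v : V) {A B : Finset W} (h : A ⊆ B) (f : W → V) :
    restrictTo v A (restrictTo v B f) = restrictTo v A f := by
  funext w
  unfold restrictTo
  by_cases hw : w ∈ A
  · simp [hw, h hw]
  · simp [hw]

open Classical in
/-- The number of edges of `H` with both ends in `A`. -/
noncomputable def edgesInside {W : Type} [Fintype W] (H : SimpleGraph W) (A : Finset W) : ℕ :=
  (H.edgeFinset.filter fun e => ∀ w ∈ e, w ∈ A).card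

lemma edgesInside_univ {W : Type} [Fintype W] (H : SimpleGraph W) :
    edgesInside H Finset.univ = H.edgeSet.ncard := by
  classical
  rw [edgesInside, ← SimpleGraph.coe_edgeFinset, Set.ncard_coe_finset]
  simp

lemma edgesInside_singleton {W : Type} [Fintype W] (H : SimpleGraph W) (r : W) :
    edgesInside H {r} = 0 := by
  classical
  rw [edgesInside, Finset.card_eq_zero, Finset.filter_eq_empty_iff]
  intro e
  induction e using Sym2.ind with
  | _ a b =>
    intro he h
    have ha : a = r := by simpa using h a (by simp)
    have hb : b = r := by simpa using h b (by simp)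
    subst ha
    subst hb
    simp at he

open Classical in
lemma edgesInside_insert {W : Type} [Fintype W] (H : SimpleGraph W) {A : Finset W} {x : W}
    (hx : x ∉ A) :
    edgesInside H (insert x A) = edgesInside H A + (A.filter (H.Adj x)).card := by
  have hinj : Set.InjOn (fun u => s(x, u)) (A.filter (H.Adj x) : Set W) := by
    intro a _ b _ hab
    exact Sym2.congr_right.1 hab
  rw [edgesInside, edgesInside, ← Finset.card_image_of_injOn hinj, ← Finset.card_union_of_disjoint]
  · congr 1
    ext e
    induction e using Sym2.ind with
    | _ a b =>
      simp only [Finset.mem_filter, SimpleGraph.mem_edgeFinset, SimpleGraph.mem_edgeSet,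
        Sym2.mem_iff, Finset.mem_insert, Finset.mem_union, Finset.mem_image, forall_eq_or_imp,
        forall_eq, Sym2.eq_iff]
      constructor
      · rintro ⟨hab, rfl | ha, rfl | hb⟩
        · exact absurd hab (H.loopless.irrefl _)
        · exact Or.inr ⟨b, ⟨hb, hab⟩, Or.inl ⟨rfl, rfl⟩⟩
        · exact Or.inr ⟨a, ⟨ha, hab.symm⟩, Or.inr ⟨rfl, rfl⟩⟩
        · exact Or.inl ⟨hab, ha, hb⟩
      · rintro (⟨hab, ha, hb⟩ | ⟨u, ⟨hu, hxu⟩, ⟨rfl, rfl⟩ | ⟨rfl, rfl⟩⟩)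
        · exact ⟨hab, Or.inr ha, Or.inr hb⟩
        · exact ⟨hxu, Or.inl rfl, Or.inr hu⟩
        · exact ⟨hxu.symm, Or.inr hu, Or.inl rfl⟩
  · rw [Finset.disjoint_left]
    intro e he he'
    obtain ⟨u, -, rfl⟩ := Finset.mem_image.1 he'
    exact hx ((Finset.mem_filter.1 he).2 x (by simp))

lemma ncard_commonNeighbors_le {V : Type} [Fintype V] (G : SimpleGraph V) [DecidableRel G.Adj]
    (m : ℕ) {S : Finset V} (hS : S.Nonempty) (hns : ¬ IsSpecialSet G m G.maxDegree S) :
    ({w : V | ∀ u ∈ S, G.Adj u w}.ncard : ℝ) ≤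
      (G.maxDegree : ℝ) ^ ((S.card : ℝ) - ((m : ℝ) / ((m : ℝ) - 1)) * ((S.card : ℝ) - 1)) := by
  classical
  by_cases h2 : 2 ≤ S.card
  · by_contra! h
    exact hns ⟨h2, h⟩
  · have h1 : S.card = 1 := by have := hS.card_pos; omega
    obtain ⟨u, rfl⟩ := Finset.card_eq_one.1 h1
    have hset : {w : V | ∀ u' ∈ ({u} : Finset V), G.Adj u' w} = (G.neighborFinset u : Set V) := by
      ext w; simp
    rw [hset, Set.ncard_coe_finset, G.card_neighborFinset_eq_degree]
    simpa using G.degree_le_maxDegree u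

open Classical in
/-- The restrictions to `insert x A` of the homomorphisms in `F` are at most `B` times as many as
the restrictions to `A`, if the images of the neighbors of `x` in `A` always have at most `B` common
neighbors. -/
lemma card_image_restrictTo_insert_le {V W : Type} [Fintype V] [Fintype W] (G : SimpleGraph V)
    (H : SimpleGraph W) (v : V) (F : Finset (W → V))
    (hF : ∀ f ∈ F, ∀ x y, H.Adj x y → G.Adj (f x) (f y)) (A : Finset W) (x : W) (B : ℝ)
    (hB : ∀ f ∈ F,
      ({w : V | ∀ u ∈ (A.filter (H.Adj x)).image f, G.Adj u w}.ncard : ℝ) ≤ B) :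
    ((F.image (restrictTo v (insert x A))).card : ℝ) ≤ (F.image (restrictTo v A)).card * B := by
  have himage : (F.image (restrictTo v (insert x A))).image (restrictTo v A) =
      F.image (restrictTo v A) := by
    rw [Finset.image_image]
    exact Finset.image_congr fun f _ => restrictTo_restrictTo v (Finset.subset_insert x A) f
  rw [Finset.card_eq_sum_card_image (restrictTo v A), himage, Nat.cast_sum, ← nsmul_eq_mul]
  refine Finset.sum_le_card_nsmul _ _ _ fun g hg => ?_
  obtain ⟨f, hf, rfl⟩ := Finset.mem_image.1 hg
  refine le_trans ?_ (hB f hf)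
  rw [Nat.cast_le, ← Set.ncard_coe_finset]
  refine Set.ncard_le_ncard_of_injOn (fun h => h x) ?_ ?_ (Set.toFinite _)
  · intro h hh
    obtain ⟨hh, hhf⟩ := Finset.mem_filter.1 (Finset.mem_coe.1 hh)
    obtain ⟨f', hf', rfl⟩ := Finset.mem_image.1 hh
    rw [restrictTo_restrictTo v (Finset.subset_insert x A)] at hhf
    intro u hu
    obtain ⟨w, hw, rfl⟩ := Finset.mem_image.1 hu
    obtain ⟨hwA, hxw⟩ := Finset.mem_filter.1 hw
    have hww : f' w = f w := by simpa [restrictTo, hwA] using congrFun hhf w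
    have hadj := hF f' hf' w x hxw.symm
    rw [hww] at hadj
    simpa [restrictTo] using hadj
  · intro h hh h' hh' hx
    obtain ⟨hh, hhf⟩ := Finset.mem_filter.1 (Finset.mem_coe.1 hh)
    obtain ⟨hh', hhf'⟩ := Finset.mem_filter.1 (Finset.mem_coe.1 hh')
    obtain ⟨f₁, -, rfl⟩ := Finset.mem_image.1 hh
    obtain ⟨f₂, -, rfl⟩ := Finset.mem_image.1 hh'
    funext w
    by_cases hwA : w ∈ A
    · simpa [restrictTo, hwA] using congrFun (hhf.trans hhf'.symm) w
    by_cases hwx : w = x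
    · subst hwx
      exact hx
    · simp [restrictTo, hwA, hwx]

open Classical in
lemma exists_card_image_restrictTo_le {V W : Type} [Fintype V] [Fintype W] (G : SimpleGraph V)
    [DecidableRel G.Adj] (hΔ : 0 < G.maxDegree) {m : ℕ} (hm : 2 ≤ m) (H : SimpleGraph W)
    (hconn : H.Connected) (v : V) (r : W) (F : Finset (W → V))
    (hF : ∀ f ∈ F, ∀ x y, H.Adj x y → G.Adj (f x) (f y))
    (hinj : ∀ f ∈ F, Function.Injective f) (hr : ∀ f ∈ F, f r = v)
    (hns : ∀ f ∈ F, ∀ (x : W) (T : Finset W), (∀ y ∈ T, H.Adj x y) →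
      ¬ IsSpecialSet G m G.maxDegree (T.image f))
    (k : ℕ) (hk : k + 1 ≤ Fintype.card W) :
    ∃ A : Finset W, r ∈ A ∧ A.card = k + 1 ∧
      ((F.image (restrictTo v A)).card : ℝ) ≤ (G.maxDegree : ℝ) ^
        (((m : ℝ) / ((m : ℝ) - 1)) * (k : ℝ) - (edgesInside H A : ℝ) / ((m : ℝ) - 1)) := by
  induction k with
  | zero =>
    refine ⟨{r}, by simp, by simp, ?_⟩
    have hsub : F.image (restrictTo v {r}) ⊆ {fun _ => v} := by
      intro g hg
      obtain ⟨f, hf, rfl⟩ := Finset.mem_image.1 hg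
      rw [Finset.mem_singleton]
      funext w
      by_cases hw : w = r
      · subst hw
        simp [restrictTo, hr f hf]
      · simp [restrictTo, hw]
    simpa [edgesInside_singleton] using Finset.card_le_card hsub
  | succ k ih =>
    obtain ⟨A, hrA, hcard, hA⟩ := ih (by omega)
    obtain ⟨y, hy⟩ : ∃ y, y ∉ A := by
      by_contra! h
      rw [Finset.eq_univ_iff_forall.2 h, Finset.card_univ] at hcard
      omega
    obtain ⟨p⟩ := hconn.preconnected r y
    obtain ⟨d, -, hdA, hxA⟩ := p.exists_boundary_dart (A : Set W) (by simpa) (by simpa)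
    have hadj := d.adj
    set a := d.fst
    set x := d.snd
    rw [Finset.mem_coe] at hdA hxA
    refine ⟨insert x A, by simp [hrA], by rw [Finset.card_insert_of_notMem hxA, hcard], ?_⟩
    set T := A.filter (H.Adj x) with hT
    have hTne : T.Nonempty := ⟨a, Finset.mem_filter.2 ⟨hdA, hadj.symm⟩⟩
    have hB := card_image_restrictTo_insert_le G H v F hF A x
      ((G.maxDegree : ℝ) ^ ((T.card : ℝ) - ((m : ℝ) / ((m : ℝ) - 1)) * ((T.card : ℝ) - 1)))
      (fun f hf => by
        have := ncard_commonNeighbors_le G m (hTne.image f)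
          (hns f hf x T fun y hy => (Finset.mem_filter.1 hy).2)
        rwa [Finset.card_image_of_injective _ (hinj f hf)] at this)
    refine hB.trans ?_
    have hΔ' : (0 : ℝ) < G.maxDegree := by exact_mod_cast hΔ
    refine (mul_le_mul_of_nonneg_right hA (by positivity)).trans ?_
    rw [← Real.rpow_add hΔ', edgesInside_insert H hxA]
    have hm' : (m : ℝ) - 1 ≠ 0 := by
      have : (2 : ℝ) ≤ m := by exact_mod_cast hm
      linarith
    refine le_of_eq ?_
    congr 1
    push_cast
    field_simp
    ring

theorem stmt15 (m : ℕ) (hm : 2 ≤ m) {V : Type} [Fintype V] (G : SimpleGraph V)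
    [DecidableRel G.Adj] (Δ : ℕ) (hΔ : G.maxDegree = Δ)
    {W : Type} [Fintype W] (H : SimpleGraph W) (V₁ V₂ : Set W)
    (hcover : ∀ x, x ∈ V₁ ∨ x ∈ V₂) (hdisj : Disjoint V₁ V₂)
    (hind₁ : ∀ x ∈ V₁, ∀ y ∈ V₁, ¬ H.Adj x y)
    (hind₂ : ∀ x ∈ V₂, ∀ y ∈ V₂, ¬ H.Adj x y)
    (hconn : H.Connected) (hn : 3 ≤ Fintype.card W) (hmH : m ≤ H.edgeSet.ncard)
    (v : V) :
    ({f : W → V | Function.Injective f ∧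
        (∀ x y, H.Adj x y → G.Adj (f x) (f y)) ∧ v ∈ Set.range f ∧
        ∀ S : Finset V, ((S : Set V) ⊆ f '' V₁ ∨ (S : Set V) ⊆ f '' V₂) →
          ¬ IsSpecialSet G m Δ S}.ncard : ℝ) ≤
      (Fintype.card W : ℝ) *
        (Δ : ℝ) ^ (((m : ℝ) / ((m : ℝ) - 1)) * ((Fintype.card W : ℝ) - 2)
          - ((H.edgeSet.ncard : ℝ) - (m : ℝ)) / ((m : ℝ) - 1)) := by
  classical
  subst hΔ
  set E := {f : W → V | Function.Injective f ∧
        (∀ x y, H.Adj x y → G.Adj (f x) (f y)) ∧ v ∈ Set.range f ∧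
        ∀ S : Finset V, ((S : Set V) ⊆ f '' V₁ ∨ (S : Set V) ⊆ f '' V₂) →
          ¬ IsSpecialSet G m G.maxDegree S} with hE
  rcases Set.eq_empty_or_nonempty E with hempty | ⟨f₀, -, hf₀, -⟩
  · rw [hempty, Set.ncard_empty, Nat.cast_zero]
    positivity
  have hpos : 0 < G.maxDegree := by
    obtain ⟨e, he⟩ := Set.nonempty_of_ncard_ne_zero (s := H.edgeSet) (by omega)
    induction e using Sym2.ind with
    | _ a b =>
      exact ((G.degree_pos_iff_exists_adj _).2 ⟨_, hf₀ a b he⟩).trans_le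
        (G.degree_le_maxDegree _)
  have hrooted : ∀ r : W, ((E.toFinset.filter fun f => f r = v).card : ℝ) ≤
      (G.maxDegree : ℝ) ^ (((m : ℝ) / ((m : ℝ) - 1)) * ((Fintype.card W : ℝ) - 2)
          - ((H.edgeSet.ncard : ℝ) - (m : ℝ)) / ((m : ℝ) - 1)) := by
    intro r
    have hmem : ∀ f ∈ E.toFinset.filter (fun f => f r = v), f ∈ E ∧ f r = v := by
      intro f hf
      simpa using hf
    obtain ⟨A, -, hcard, hA⟩ := exists_card_image_restrictTo_le G hpos hm H hconn v r
      (E.toFinset.filter fun f => f r = v) (fun f hf => (hmem f hf).1.2.1)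
      (fun f hf => (hmem f hf).1.1) (fun f hf => (hmem f hf).2)
      (fun f hf x T hT => by
        refine (hmem f hf).1.2.2.2 _ ?_
        rw [Finset.coe_image]
        rcases hcover x with hx | hx
        · exact Or.inr (Set.image_mono fun y hy =>
            (hcover y).resolve_left fun h => hind₁ x hx y h (hT y hy))
        · exact Or.inl (Set.image_mono fun y hy =>
            (hcover y).resolve_right fun h => hind₂ x hx y h (hT y hy)))
      (Fintype.card W - 1) (by omega)
    obtain rfl : A = Finset.univ := by
      rw [← Finset.card_eq_iff_eq_univ]
      omega
    have hid : (restrictTo v Finset.univ : (W → V) → W → V) = id := by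
      funext f w
      simp [restrictTo]
    rw [hid, Finset.image_id, edgesInside_univ] at hA
    refine hA.trans (le_of_eq ?_)
    have hm' : (m : ℝ) - 1 ≠ 0 := by
      have : (2 : ℝ) ≤ m := by exact_mod_cast hm
      linarith
    congr 1
    rw [Nat.cast_sub (by omega)]
    field_simp
    push_cast
    ring
  have hunion : E.toFinset ⊆ Finset.univ.biUnion fun r => E.toFinset.filter fun f => f r = v := by
    intro f hf
    obtain ⟨r, hr⟩ := (Set.mem_toFinset.1 hf).2.2.1
    exact Finset.mem_biUnion.2 ⟨r, Finset.mem_univ r, Finset.mem_filter.2 ⟨hf, hr⟩⟩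
  have hsum := (Finset.card_le_card hunion).trans Finset.card_biUnion_le
  rw [Set.ncard_eq_toFinset_card']
  calc (E.toFinset.card : ℝ)
      ≤ ∑ r : W, ((E.toFinset.filter fun f => f r = v).card : ℝ) := by exact_mod_cast hsum
    _ ≤ _ := Finset.sum_le_card_nsmul _ _ _ fun r _ => hrooted r
    _ = _ := by rw [nsmul_eq_mul, Finset.card_univ]
end

section
/- Let V be a finite set and κ a positive integer, and consider partial colorings φ : V → {1,…,κ} ∪ {•} (where φ(v) = • means v is uncolored). Suppose that for every v ∈ V a set F(v) of partial colorings is given such that v is colored in every member of F(v), and that every F(v) is closed upward (whenever φ ∈ F(v) and φ' is obtained from φ by assigning a color to some uncolored vertex, then φ' ∈ F(v)). Define a partial coloring φ to be allowed if either no vertex is colored in φ, or there exists a colored vertex v with φ ∉ F(v) such that the partial coloring obtained from φ by uncoloring v is allowed. Then the set of allowed colorings is closed downward: for every allowed coloring φ and every colored vertex u of φ, the coloring obtained from φ by uncoloring u is allowed. -/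
/-- A partial coloring `φ : V → Option (Fin κ)` (where `none` means uncolored) is
allowed (with respect to the family `F` of forbidden partial colorings anchored at
each vertex) if either no vertex is colored, or some colored vertex `v` satisfies
`φ ∉ F v` and uncoloring `v` yields an allowed coloring. -/
inductive Allowed {V : Type} [DecidableEq V] {κ : ℕ}
    (F : V → Set (V → Option (Fin κ))) : (V → Option (Fin κ)) → Prop
  | empty (φ : V → Option (Fin κ)) (h : ∀ v, φ v = none) : Allowed F φ
  | step (φ : V → Option (Fin κ)) (v : V) (hv : (φ v).isSome) (hnf : φ ∉ F v)
      (h : Allowed F (Function.update φ v none)) : Allowed F φ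

theorem stmt16 {V : Type} [Fintype V] [DecidableEq V] (κ : ℕ) (hκ : 0 < κ)
    (F : V → Set (V → Option (Fin κ)))
    (hcolored : ∀ (v : V) (φ : V → Option (Fin κ)), φ ∈ F v → (φ v).isSome)
    (hup : ∀ (v : V) (φ : V → Option (Fin κ)), φ ∈ F v →
      ∀ u, φ u = none → ∀ c : Fin κ, Function.update φ u (some c) ∈ F v)
    (φ : V → Option (Fin κ)) (hφ : Allowed F φ) (u : V) (hu : (φ u).isSome) :
    Allowed F (Function.update φ u none) := by
  induction hφ with
  | empty φ h => simp [h u] at hu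
  | step φ v hv hnf h ih =>
    by_cases huv : u = v
    · exact huv ▸ h
    · refine Allowed.step _ v (by simpa [Function.update_of_ne (Ne.symm huv)] using hv) ?_ ?_
      · intro hmem
        obtain ⟨c, hc⟩ := Option.isSome_iff_exists.mp hu
        have hφ := hup v _ hmem u (by simp) c
        rw [Function.update_idem, ← hc, Function.update_eq_self] at hφ
        exact hnf hφ
      · rw [Function.update_comm huv]
        exact ih (by simpa [Function.update_of_ne huv] using hu)
end

section
/- Let T be a finite nonempty index set, and for each j ∈ T let C_j > 0 be a real number and s_j ≥ 1 an integer, with s_j ≥ 2 for at least one j ∈ T. Define Q(x) = 1 + Σ_{j∈T} C_j x^{s_j} and P(x) = −1 + Σ_{j∈T} (s_j − 1)·C_j·x^{s_j}. Then P has a unique root x_0 in (0, ∞), and the function x ↦ Q(x)/x on (0, ∞) attains its minimum at x = x_0; i.e., Q(x)/x ≥ Q(x_0)/x_0 for all x > 0. -/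
/-- `∑ (s j - 1) C j x ^ s j` is strictly increasing on `[0, ∞)`. -/
theorem strictMonoOn_sum_sub_one_mul_pow {T : Type} [Fintype T]
    {C : T → ℝ} (hC : ∀ j, 0 < C j)
    {s : T → ℕ} (hs : ∀ j, 1 ≤ s j) (hs2 : ∃ j, 2 ≤ s j) :
    StrictMonoOn (fun x : ℝ => ∑ j, ((s j : ℝ) - 1) * C j * x ^ s j) (Set.Ici 0) := by
  intro x hx y _ hxy
  obtain ⟨k, hk⟩ := hs2
  refine Finset.sum_lt_sum (fun j _ => ?_) ⟨k, Finset.mem_univ k, ?_⟩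
  · have hj : (1 : ℝ) ≤ s j := by exact_mod_cast hs j
    exact mul_le_mul_of_nonneg_left (pow_le_pow_left₀ hx hxy.le _)
      (mul_nonneg (by linarith) (hC j).le)
  · have hk' : (2 : ℝ) ≤ s k := by exact_mod_cast hk
    exact mul_lt_mul_of_pos_left (pow_lt_pow_left₀ hxy hx (by omega))
      (mul_pos (by linarith) (hC k))

/-- The function `∑ (s j - 1) C j x ^ s j` takes the value `1` on `(0, ∞)`. -/
theorem exists_pos_sum_sub_one_mul_pow_eq_one {T : Type} [Fintype T]
    {C : T → ℝ} (hC : ∀ j, 0 < C j)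
    {s : T → ℕ} (hs : ∀ j, 1 ≤ s j) (hs2 : ∃ j, 2 ≤ s j) :
    ∃ x : ℝ, 0 < x ∧ ∑ j, ((s j : ℝ) - 1) * C j * x ^ s j = 1 := by
  obtain ⟨k, hk⟩ := hs2
  set f : ℝ → ℝ := fun x => ∑ j, ((s j : ℝ) - 1) * C j * x ^ s j with hf
  have hf0 : f 0 = 0 := Finset.sum_eq_zero fun j _ => by
    rw [zero_pow (by have := hs j; omega), mul_zero]
  have hCk := hC k
  set M : ℝ := 1 + 1 / C k with hM
  have hM1 : 1 ≤ M := by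
    have : 0 < 1 / C k := by positivity
    linarith
  have hfM : 1 ≤ f M := by
    have hterm : ((s k : ℝ) - 1) * C k * M ^ s k ≤ f M := by
      refine Finset.single_le_sum (f := fun j => ((s j : ℝ) - 1) * C j * M ^ s j)
        (fun j _ => ?_) (Finset.mem_univ k)
      have hj : (1 : ℝ) ≤ s j := by exact_mod_cast hs j
      exact mul_nonneg (mul_nonneg (by linarith) (hC j).le) (by positivity)
    have hk' : (2 : ℝ) ≤ s k := by exact_mod_cast hk
    have hpow : M ≤ M ^ s k := le_self_pow₀ hM1 (by omega)
    have hCM : C k * M = C k + 1 := by rw [hM]; field_simp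
    calc (1 : ℝ) ≤ C k * M := by linarith
      _ ≤ ((s k : ℝ) - 1) * C k * M ^ s k := by
        have hsk : (1 : ℝ) ≤ (s k : ℝ) - 1 := by linarith
        have hcoef : C k ≤ ((s k : ℝ) - 1) * C k := le_mul_of_one_le_left hCk.le hsk
        exact mul_le_mul hcoef hpow (by linarith) (by linarith)
      _ ≤ f M := hterm
  have hcont : ContinuousOn f (Set.Icc 0 M) := by
    rw [hf]; fun_prop
  obtain ⟨x, hx, hfx⟩ := intermediate_value_Icc (by linarith : (0 : ℝ) ≤ M) hcont
    ⟨by rw [hf0]; exact zero_le_one, hfM⟩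
  refine ⟨x, hx.1.lt_of_ne ?_, hfx⟩
  rintro rfl
  rw [hf0] at hfx
  exact zero_ne_one hfx

/-- The tangent line bound for `y ↦ y ^ n`, in multiplicative form. -/
theorem pow_mul_one_add_mul_le_pow {a x : ℝ} (ha : 0 < a) (hx : 0 < x) (n : ℕ) :
    a ^ n * (1 + n * (x / a - 1)) ≤ x ^ n := by
  have hxa : 0 < x / a := div_pos hx ha
  have h := one_add_mul_le_pow (a := x / a - 1) (by linarith) n
  calc a ^ n * (1 + n * (x / a - 1)) ≤ a ^ n * (1 + (x / a - 1)) ^ n := by gcongr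
    _ = x ^ n := by rw [add_sub_cancel, ← mul_pow, mul_div_cancel₀ _ ha.ne']

theorem stmt17 {T : Type} [Fintype T] [Nonempty T]
    (C : T → ℝ) (hC : ∀ j, 0 < C j)
    (s : T → ℕ) (hs : ∀ j, 1 ≤ s j) (hs2 : ∃ j, 2 ≤ s j) :
    ∃ x₀ : ℝ, 0 < x₀ ∧
      (-1 + ∑ j, ((s j : ℝ) - 1) * C j * x₀ ^ s j = 0) ∧
      (∀ x : ℝ, 0 < x → -1 + ∑ j, ((s j : ℝ) - 1) * C j * x ^ s j = 0 → x = x₀) ∧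
      (∀ x : ℝ, 0 < x →
        (1 + ∑ j, C j * x₀ ^ s j) / x₀ ≤ (1 + ∑ j, C j * x ^ s j) / x) := by
  obtain ⟨x₀, hx₀, hroot⟩ := exists_pos_sum_sub_one_mul_pow_eq_one hC hs hs2
  refine ⟨x₀, hx₀, by linarith, fun x hx hPx => ?_, fun x hx => ?_⟩
  · refine (strictMonoOn_sum_sub_one_mul_pow hC hs hs2).injOn hx.le hx₀.le ?_
    linarith
  · set t := x / x₀ with ht
    have hsum : ∑ j, C j * (x₀ ^ s j * (1 + s j * (t - 1))) ≤ ∑ j, C j * x ^ s j :=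
      Finset.sum_le_sum fun j _ =>
        mul_le_mul_of_nonneg_left (pow_mul_one_add_mul_le_pow hx₀ hx _) (hC j).le
    have hsplit : ∑ j, C j * (x₀ ^ s j * (1 + s j * (t - 1))) =
        t * ∑ j, C j * x₀ ^ s j + (t - 1) * ∑ j, ((s j : ℝ) - 1) * C j * x₀ ^ s j := by
      rw [Finset.mul_sum, Finset.mul_sum, ← Finset.sum_add_distrib]
      exact Finset.sum_congr rfl fun j _ => by ring
    rw [hsplit, hroot] at hsum
    rw [le_div_iff₀ hx, div_mul_eq_mul_div, mul_div_assoc, ← ht]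
    linarith
end

section
/- Let T be a finite set of types, let s_j and C_j be positive integers for each j ∈ T, and let n be a nonnegative integer. Define an annotated record of size t to be a lattice path of unit up-steps and unit down-steps starting at level 0, never going below level 0, ending at a level between 0 and n, having exactly t up-steps, in which every maximal run of consecutive down-steps immediately follows an up-step, has length equal to s_j for some j ∈ T, and is annotated by a pair (j, k) with s_j equal to the run length and k ∈ {1,…,C_j}. Let r_t be the number of annotated records of size t, and for x ∈ (0,1] let Q(x) = 1 + Σ_{j∈T} C_j x^{s_j}. Then for every x ∈ (0,1], r_t = o((Q(x)/x)^t) as t → ∞. -/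
open Filter Asymptotics

/-- An item of an annotated record: `Sum.inl ()` is an up-step, and `Sum.inr ⟨j, k⟩`
is a descent (maximal run of down-steps) of length `s j` annotated with the pair
`(j, k)` where `k ∈ {1, …, C j}`. -/
abbrev RecordItem (T : Type) (C : T → ℕ) : Type := Unit ⊕ (Σ j : T, Fin (C j))

/-- The level reached by a record: each up-step adds `1`, and a descent annotated by
`(j, k)` consists of `s j` down-steps, subtracting `s j`. -/
def recordLevel {T : Type} {C : T → ℕ} (s : T → ℕ) (w : List (RecordItem T C)) : ℤ :=
  (w.map fun a => match a with
    | Sum.inl _ => (1 : ℤ)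
    | Sum.inr ⟨j, _⟩ => -(s j : ℤ)).sum

/-- `w` is an annotated record (with final level at most `n`): the corresponding
lattice path starts at level `0`, never goes below level `0`, ends at a level between
`0` and `n`, and every maximal run of consecutive down-steps immediately follows an
up-step (so a descent never starts the path and never immediately follows another
descent), has length `s j` and is annotated by a pair `(j, k)` with `k ∈ {1,…,C j}`. -/
def IsRecord {T : Type} {C : T → ℕ} (s : T → ℕ) (n : ℕ)
    (w : List (RecordItem T C)) : Prop :=
  (∀ p : List (RecordItem T C), p <+: w → 0 ≤ recordLevel s p) ∧
  recordLevel s w ≤ (n : ℤ) ∧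
  (∀ a, w.head? = some a → a.isLeft) ∧
  List.Chain' (fun a b : RecordItem T C => b.isRight → a.isLeft = true) w

/-- The size of a record is its number of up-steps. -/
def recordSize {T : Type} {C : T → ℕ} (w : List (RecordItem T C)) : ℕ :=
  w.countP Sum.isLeft
section PolynomialCoefficients

open Polynomial

lemma coeff_mul_nonneg_of_nonneg {P R : ℝ[X]} (hP : ∀ i, 0 ≤ P.coeff i)
    (hR : ∀ i, 0 ≤ R.coeff i) (i : ℕ) : 0 ≤ (P * R).coeff i := by
  rw [coeff_mul]
  exact Finset.sum_nonneg fun y _ => mul_nonneg (hP _) (hR _)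

lemma coeff_pow_nonneg_of_nonneg {P : ℝ[X]} (hP : ∀ i, 0 ≤ P.coeff i) (t i : ℕ) :
    0 ≤ (P ^ t).coeff i := by
  induction t generalizing i with
  | zero =>
    rw [pow_zero, coeff_one]
    split_ifs <;> norm_num
  | succ t ih =>
    rw [pow_succ]
    exact coeff_mul_nonneg_of_nonneg ih hP i

lemma sum_coeff_le_eval_one {P : ℝ[X]} (hP : ∀ i, 0 ≤ P.coeff i) (S : Finset ℕ) :
    ∑ i ∈ S, P.coeff i ≤ P.eval 1 := by
  classical
  have h : P.eval 1 = ∑ i ∈ P.support, P.coeff i := by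
    simp [eval_eq_sum, Polynomial.sum]
  rw [h, ← Finset.sum_filter_ne_zero]
  refine Finset.sum_le_sum_of_subset_of_nonneg (fun i hi => ?_) fun i _ _ => hP i
  exact mem_support_iff.2 (Finset.mem_filter.1 hi).2

lemma mul_coeff_le_coeff_mul {P R : ℝ[X]} (hP : ∀ i, 0 ≤ P.coeff i)
    (hR : ∀ i, 0 ≤ R.coeff i) (i j : ℕ) :
    P.coeff i * R.coeff j ≤ (P * R).coeff (i + j) := by
  rw [coeff_mul]
  exact Finset.single_le_sum (f := fun y : ℕ × ℕ => P.coeff y.1 * R.coeff y.2)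
    (a := (i, j))
    (fun y _ => mul_nonneg (hP _) (hR _)) (Finset.HasAntidiagonal.mem_antidiagonal.2 rfl)

lemma coeff_mul_le_eval_one_mul {R F : ℝ[X]} (hR : ∀ i, 0 ≤ R.coeff i) {g : ℝ} (hg : 0 ≤ g)
    (hF : ∀ i, F.coeff i ≤ g) (d : ℕ) : (R * F).coeff d ≤ R.eval 1 * g := by
  rw [coeff_mul, Finset.Nat.sum_antidiagonal_eq_sum_range_succ_mk]
  calc ∑ k ∈ Finset.range d.succ, R.coeff k * F.coeff (d - k)
      ≤ ∑ k ∈ Finset.range d.succ, R.coeff k * g :=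
        Finset.sum_le_sum fun k _ => mul_le_mul_of_nonneg_left (hF _) (hR k)
    _ = (∑ k ∈ Finset.range d.succ, R.coeff k) * g := (Finset.sum_mul _ _ _).symm
    _ ≤ _ := mul_le_mul_of_nonneg_right (sum_coeff_le_eval_one hR _) hg

/-- If a coefficient of a product with a probability polynomial is nearly maximal, then the
coefficients it averages are nearly maximal. -/
lemma coeff_mul_le_of_le_coeff {R F : ℝ[X]} (hR : ∀ i, 0 ≤ R.coeff i) (hR1 : R.eval 1 = 1)
    {g : ℝ} (hg : 0 ≤ g) (hF : ∀ i, F.coeff i ≤ g) {δ : ℝ} {a : ℕ} (hδ : δ ≤ R.coeff a)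
    (d : ℕ) :
    (R * F).coeff d ≤ (1 - δ) * g + δ * (if a ≤ d then F.coeff (d - a) else 0) := by
  have hsub : ∀ i, 0 ≤ (R - C δ * X ^ a).coeff i := by
    intro i
    rw [coeff_sub, coeff_C_mul, coeff_X_pow]
    split_ifs with h
    · subst h
      linarith
    · simpa using hR i
  have h := coeff_mul_le_eval_one_mul hsub hg hF d
  have hsplit : R * F = (R - C δ * X ^ a) * F + C δ * (X ^ a * F) := by ring
  have heval : (R - C δ * X ^ a).eval 1 = 1 - δ := by simp [hR1]
  rw [heval] at h
  rw [hsplit, coeff_add, coeff_C_mul, coeff_X_pow_mul']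
  linarith

lemma coeff_pow_mul_pos {P : ℝ[X]} (hP : ∀ i, 0 ≤ P.coeff i) {s : ℕ} (h0 : 0 < P.coeff 0)
    (hs : 0 < P.coeff s) (K j : ℕ) (hj : j ≤ K) : 0 < (P ^ K).coeff (s * j) := by
  induction K generalizing j with
  | zero =>
    obtain rfl : j = 0 := by omega
    simp
  | succ K ih =>
    rw [pow_succ]
    rcases Nat.lt_or_ge K j with h | h
    · obtain rfl : j = K + 1 := by omega
      exact (mul_pos (ih K le_rfl) hs).trans_le
        (mul_coeff_le_coeff_mul (coeff_pow_nonneg_of_nonneg hP K) hP _ _)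
    · exact (mul_pos (ih j h) h0).trans_le
        (mul_coeff_le_coeff_mul (coeff_pow_nonneg_of_nonneg hP K) hP _ _)

/-- The largest coefficient of the powers of a nondegenerate probability polynomial tends
to zero. -/
lemma eventually_coeff_pow_le {P : ℝ[X]} (hP : ∀ i, 0 ≤ P.coeff i) (hP1 : P.eval 1 = 1)
    {s : ℕ} (hs : 0 < s) (h0 : 0 < P.coeff 0) (hps : 0 < P.coeff s) {ε : ℝ} (hε : 0 < ε) :
    ∀ᶠ t in atTop, ∀ d, (P ^ t).coeff d ≤ ε := by
  have hnn := coeff_pow_nonneg_of_nonneg hP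
  have heval : ∀ t, (P ^ t).eval 1 = 1 := fun t => by simp [hP1]
  have hmono : ∀ g t, (∀ d, (P ^ t).coeff d ≤ g) → ∀ K d, (P ^ (K + t)).coeff d ≤ g := by
    intro g t h K d
    have := coeff_mul_le_eval_one_mul (hnn K) ((hnn t 0).trans (h 0)) h d
    rwa [heval, one_mul, ← pow_add] at this
  set G : Set ℝ := {g | ∃ t, ∀ d, (P ^ t).coeff d ≤ g}
  have hGbdd : BddBelow G := ⟨0, fun g ⟨t, ht⟩ => (hnn t 0).trans (ht 0)⟩
  have hGne : G.Nonempty := by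
    refine ⟨1, 0, fun d => ?_⟩
    rw [pow_zero, coeff_one]
    split_ifs <;> norm_num
  have hM : sInf G ≤ 0 := by
    by_contra! hM
    set M := sInf G
    obtain ⟨K, hK⟩ := exists_nat_gt (2 / M)
    obtain ⟨j₀, hj₀, hmin⟩ := Finset.exists_min_image (Finset.range (K + 1))
      (fun j => (P ^ K).coeff (s * j)) ⟨0, by simp⟩
    set δ := (P ^ K).coeff (s * j₀)
    have hδ : 0 < δ :=
      coeff_pow_mul_pos hP h0 hps K j₀ (Nat.lt_succ_iff.1 (Finset.mem_range.1 hj₀))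
    have hη : 0 < δ * M / 4 := by positivity
    obtain ⟨g, hgG, hgM⟩ := exists_lt_of_csInf_lt hGne (lt_add_of_pos_right M hη)
    have hMg : M ≤ g := csInf_le hGbdd hgG
    obtain ⟨t, ht⟩ := hgG
    obtain ⟨d, hd⟩ : ∃ d, M - δ * M / 4 < (P ^ (K + t)).coeff d := by
      by_contra! h
      have : M ≤ M - δ * M / 4 := csInf_le hGbdd ⟨K + t, h⟩
      linarith
    have key : ∀ j ∈ Finset.range (K + 1),
        s * j ≤ d ∧ M / 2 ≤ (P ^ t).coeff (d - s * j) := by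
      intro j hj
      have h := coeff_mul_le_of_le_coeff (hnn K) (heval K) (hM.le.trans hMg) ht (hmin j hj) d
      rw [← pow_add] at h
      have h2 : M / 2 < if s * j ≤ d then (P ^ t).coeff (d - s * j) else 0 := by
        refine lt_of_mul_lt_mul_left (a := δ) ?_ hδ.le
        have : δ * M ≤ δ * g := mul_le_mul_of_nonneg_left hMg hδ.le
        linarith
      split_ifs at h2 with hle
      · exact ⟨hle, h2.le⟩
      · linarith
    have hinj : Set.InjOn (fun j => d - s * j) (Finset.range (K + 1) : Set ℕ) := by
      intro a ha b hb hab
      have ha' := (key a ha).1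
      have hb' := (key b hb).1
      have : s * a = s * b := by
        simp only at hab
        omega
      exact Nat.eq_of_mul_eq_mul_left hs this
    have hsum := sum_coeff_le_eval_one (hnn t)
      ((Finset.range (K + 1)).image fun j => d - s * j)
    rw [Finset.sum_image hinj, heval] at hsum
    have hcard := Finset.card_nsmul_le_sum (Finset.range (K + 1)) _ (M / 2)
      fun j hj => (key j hj).2
    rw [Finset.card_range, nsmul_eq_mul] at hcard
    rw [div_lt_iff₀ hM] at hK
    push_cast at hcard
    nlinarith
  obtain ⟨g, ⟨t, ht⟩, hg⟩ := exists_lt_of_csInf_lt hGne (hM.trans_lt hε)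
  filter_upwards [eventually_ge_atTop t] with u hu d
  have := hmono g t ht (u - t) d
  rw [Nat.sub_add_cancel hu] at this
  exact this.trans hg.le

end PolynomialCoefficients

section Blocks

variable {T : Type} {C : T → ℕ}

/-- The length of the optional descent that follows an up-step. -/
def blockDown (s : T → ℕ) (o : Option (Σ j : T, Fin (C j))) : ℕ :=
  o.elim 0 fun a => s a.1

/-- The word obtained from a sequence of blocks, each an up-step followed by an optional
descent. -/
def blockWord (b : List (Option (Σ j : T, Fin (C j)))) : List (RecordItem T C) :=
  b.flatMap fun o => Sum.inl () :: (o.map Sum.inr).toList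

lemma recordSize_blockWord (b : List (Option (Σ j : T, Fin (C j)))) :
    recordSize (blockWord b) = b.length := by
  induction b with
  | nil => rfl
  | cons o b ih =>
    unfold recordSize blockWord at *
    cases o <;> simp [List.flatMap_cons, List.countP_cons, ih]

lemma recordLevel_blockWord (s : T → ℕ) (b : List (Option (Σ j : T, Fin (C j)))) :
    recordLevel s (blockWord b) = b.length - ((b.map (blockDown s)).sum : ℕ) := by
  induction b with
  | nil => rfl
  | cons o b ih =>
    unfold recordLevel blockWord at *
    cases o <;> simp [List.flatMap_cons, ih, blockDown] <;> ring

lemma exists_blockWord_eq : ∀ w : List (RecordItem T C),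
    (∀ a, w.head? = some a → a.isLeft) →
    List.IsChain (fun a b : RecordItem T C => b.isRight → a.isLeft = true) w →
    ∃ b, blockWord b = w
  | [], _, _ => ⟨[], rfl⟩
  | Sum.inr a :: w, h, _ => by simpa using h _ rfl
  | [Sum.inl ()], _, _ => ⟨[none], rfl⟩
  | Sum.inl () :: Sum.inl () :: w, _, hc => by
    obtain ⟨b, hb⟩ := exists_blockWord_eq (Sum.inl () :: w) (by simp) hc.tail
    exact ⟨none :: b, by rw [← hb]; rfl⟩
  | Sum.inl () :: Sum.inr a :: w, _, hc => by
    have hhead : ∀ c, w.head? = some c → c.isLeft := by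
      intro c hcw
      cases w with
      | nil => simp at hcw
      | cons e w =>
        obtain rfl : e = c := by simpa using hcw
        have := (List.isChain_cons_cons.1 hc.tail).1
        cases e <;> simp_all
    obtain ⟨b, hb⟩ := exists_blockWord_eq w hhead hc.tail.tail
    exact ⟨some a :: b, by rw [← hb]; rfl⟩

lemma ncard_records_le [Fintype T] (s : T → ℕ) (n t : ℕ) :
    {w : List (RecordItem T C) | IsRecord s n w ∧ recordSize w = t}.ncard ≤
      (Finset.univ.filter fun p : Fin t → Option (Σ j : T, Fin (C j)) =>
        ∑ i, blockDown s (p i) ∈ Finset.Icc (t - n) t).card := by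
  classical
  rw [← Set.ncard_coe_finset]
  refine (Set.ncard_le_ncard ?_ (Set.toFinite _)).trans
    (Set.ncard_image_le (f := fun p => blockWord (List.ofFn p)) (Set.toFinite _))
  rintro w ⟨⟨hpos, hle, hhead, hchain⟩, hsize⟩
  obtain ⟨b, rfl⟩ := exists_blockWord_eq w hhead hchain
  rw [recordSize_blockWord] at hsize
  subst hsize
  have hsum : ∑ i, blockDown s (b.get i) = (b.map (blockDown s)).sum := by
    rw [← List.sum_ofFn]
    conv_rhs => rw [← List.ofFn_get b, List.map_ofFn]
    rfl
  have hpos := hpos _ List.prefix_rfl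
  rw [recordLevel_blockWord] at hpos hle
  refine ⟨b.get, ?_, by simp [List.ofFn_get]⟩
  simp only [Finset.coe_filter, Finset.mem_univ, true_and, Set.mem_ofPred_eq, Finset.mem_Icc]
  rw [hsum]
  omega

end Blocks

section BlockPolynomial

open Polynomial

variable {T : Type} [Fintype T] {C : T → ℕ}

/-- The generating polynomial of the descent length of a random block, where a descent of
length `s j` is chosen with probability proportional to `x ^ s j`. -/
noncomputable def blockPoly (C : T → ℕ) (s : T → ℕ) (x : ℝ) : ℝ[X] :=
  ∑ o : Option (Σ j : T, Fin (C j)),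
    monomial (blockDown s o) (x ^ blockDown s o / (1 + ∑ j, (C j : ℝ) * x ^ s j))

lemma coeff_blockPoly_pow (s : T → ℕ) (x : ℝ) (t d : ℕ) :
    ((blockPoly C s x) ^ t).coeff d =
      ((Finset.univ.filter fun p : Fin t → Option (Σ j : T, Fin (C j)) =>
        ∑ i, blockDown s (p i) = d).card : ℝ) *
      (x ^ d / (1 + ∑ j, (C j : ℝ) * x ^ s j) ^ t) := by
  classical
  have hprod : ∀ p : Fin t → Option (Σ j : T, Fin (C j)),
      ∏ i, (monomial (blockDown s (p i))
        (x ^ blockDown s (p i) / (1 + ∑ j, (C j : ℝ) * x ^ s j))) =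
      monomial (∑ i, blockDown s (p i))
        (x ^ (∑ i, blockDown s (p i)) / (1 + ∑ j, (C j : ℝ) * x ^ s j) ^ t) := by
    intro p
    simp_rw [← C_mul_X_pow_eq_monomial]
    rw [Finset.prod_mul_distrib, Finset.prod_pow_eq_pow_sum, ← map_prod, Finset.prod_div_distrib,
      Finset.prod_pow_eq_pow_sum, Finset.prod_const, Finset.card_univ, Fintype.card_fin]
  rw [blockPoly, Fintype.sum_pow, finsetSum_coeff, ← nsmul_eq_mul, ← Finset.sum_const,
    Finset.sum_filter]
  refine Finset.sum_congr rfl fun p _ => ?_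
  rw [hprod, coeff_monomial]
  split_ifs with h
  · rw [h]
  · rfl

lemma eval_one_blockPoly (s : T → ℕ) {x : ℝ} (hx : 0 < x) : (blockPoly C s x).eval 1 = 1 := by
  have hQ : 0 < 1 + ∑ j, (C j : ℝ) * x ^ s j := by positivity
  rw [blockPoly, eval_finsetSum]
  simp only [eval_monomial, one_pow, mul_one]
  rw [← Finset.sum_div, div_eq_one_iff_eq hQ.ne', Fintype.sum_option, Fintype.sum_sigma]
  simp [blockDown]

lemma coeff_blockPoly_pos (s : T → ℕ) {x : ℝ} (hx : 0 < x)
    (o : Option (Σ j : T, Fin (C j))) : 0 < (blockPoly C s x).coeff (blockDown s o) := by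
  have hQ : 0 < 1 + ∑ j, (C j : ℝ) * x ^ s j := by positivity
  rw [blockPoly, finsetSum_coeff]
  refine Finset.sum_pos' (fun i _ => ?_) ⟨o, Finset.mem_univ _, ?_⟩
  · rw [coeff_monomial]
    split_ifs <;> positivity
  · rw [coeff_monomial, if_pos rfl]
    positivity

lemma coeff_blockPoly_nonneg (s : T → ℕ) {x : ℝ} (hx : 0 < x) (i : ℕ) :
    0 ≤ (blockPoly C s x).coeff i := by
  rw [← pow_one (blockPoly C s x), coeff_blockPoly_pow]
  positivity

lemma ncard_records_le_sum_coeff (s : T → ℕ) (n t : ℕ) {x : ℝ} (hx0 : 0 < x) (hx1 : x ≤ 1) :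
    ({w : List (RecordItem T C) | IsRecord s n w ∧ recordSize w = t}.ncard : ℝ) ≤
      (∑ d ∈ Finset.Icc (t - n) t, ((blockPoly C s x) ^ t).coeff d) *
        ((1 + ∑ j, (C j : ℝ) * x ^ s j) / x) ^ t := by
  classical
  have hQ : 0 < 1 + ∑ j, (C j : ℝ) * x ^ s j := by positivity
  refine (Nat.cast_le.2 (ncard_records_le s n t)).trans ?_
  have hmaps : Set.MapsTo
      (fun p : Fin t → Option (Σ j : T, Fin (C j)) => ∑ i, blockDown s (p i))
      ↑(Finset.univ.filter fun p : Fin t → Option (Σ j : T, Fin (C j)) =>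
        ∑ i, blockDown s (p i) ∈ Finset.Icc (t - n) t)
      ↑(Finset.Icc (t - n) t) :=
    fun p hp => (Finset.mem_filter.1 hp).2
  rw [Finset.card_eq_sum_card_fiberwise hmaps, Nat.cast_sum,
    Finset.sum_mul]
  refine Finset.sum_le_sum fun d hd => ?_
  rw [coeff_blockPoly_pow, mul_assoc, div_pow]
  have hpow : 1 ≤ x ^ d / (1 + ∑ j, (C j : ℝ) * x ^ s j) ^ t *
      ((1 + ∑ j, (C j : ℝ) * x ^ s j) ^ t / x ^ t) := by
    rw [div_mul_div_cancel₀ (by positivity), one_le_div (by positivity)]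
    exact pow_le_pow_of_le_one hx0.le hx1 (Finset.mem_Icc.1 hd).2
  refine le_trans ?_ (le_mul_of_one_le_right (Nat.cast_nonneg _) hpow)
  exact Nat.cast_le.2 (Finset.card_le_card
    (Finset.filter_subset_filter _ (Finset.filter_subset _ _)))

lemma eventually_sum_coeff_blockPoly_pow_le (s : T → ℕ) (hs : ∀ j, 1 ≤ s j)
    (hC : ∀ j, 1 ≤ C j) (n : ℕ) {x : ℝ} (hx : 0 < x) {ε : ℝ} (hε : 0 < ε) :
    ∀ᶠ t in atTop, ∑ d ∈ Finset.Icc (t - n) t, ((blockPoly C s x) ^ t).coeff d ≤ ε := by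
  rcases isEmpty_or_nonempty T with hT | ⟨⟨j⟩⟩
  · filter_upwards [eventually_gt_atTop n] with t ht
    have hone : blockPoly C s x = 1 := by
      rw [blockPoly, Fintype.sum_option]
      simp [blockDown]
    rw [hone, one_pow, Finset.sum_eq_zero]
    · exact hε.le
    · intro d hd
      rw [Finset.mem_Icc] at hd
      rw [coeff_one, if_neg (by omega)]
  · have h0 : 0 < (blockPoly C s x).coeff 0 := coeff_blockPoly_pos s hx none
    have hsj : 0 < (blockPoly C s x).coeff (s j) :=
      coeff_blockPoly_pos s hx (some ⟨j, ⟨0, hC j⟩⟩)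
    have hn : (0 : ℝ) < n + 1 := by positivity
    filter_upwards [eventually_coeff_pow_le (coeff_blockPoly_nonneg s hx)
      (eval_one_blockPoly s hx) (hs j) h0 hsj (div_pos hε hn)] with t ht
    have hcard : ((Finset.Icc (t - n) t).card : ℝ) ≤ n + 1 := by
      rw [Nat.card_Icc]
      exact_mod_cast (by omega : t + 1 - (t - n) ≤ n + 1)
    calc _ ≤ (Finset.Icc (t - n) t).card • (ε / (n + 1)) :=
          Finset.sum_le_card_nsmul _ _ _ fun d _ => ht d
      _ ≤ (n + 1) * (ε / (n + 1)) := by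
          rw [nsmul_eq_mul]
          exact mul_le_mul_of_nonneg_right hcard (by positivity)
      _ = ε := mul_div_cancel₀ _ hn.ne'

end BlockPolynomial

theorem stmt18 (T : Type) [Fintype T] (s C : T → ℕ)
    (hs : ∀ j, 1 ≤ s j) (hC : ∀ j, 1 ≤ C j) (n : ℕ)
    (x : ℝ) (hx0 : 0 < x) (hx1 : x ≤ 1) :
    (fun t : ℕ => ({w : List (RecordItem T C) |
        IsRecord s n w ∧ recordSize w = t}.ncard : ℝ))
      =o[atTop]
    fun t : ℕ => ((1 + ∑ j, (C j : ℝ) * x ^ s j) / x) ^ t := by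
  have hQ : 0 < 1 + ∑ j, (C j : ℝ) * x ^ s j := by positivity
  refine IsLittleO.of_bound fun ε hε => ?_
  filter_upwards [eventually_sum_coeff_blockPoly_pow_le s hs hC n hx0 hε] with t ht
  have hpos : 0 ≤ ((1 + ∑ j, (C j : ℝ) * x ^ s j) / x) ^ t := by positivity
  rw [Real.norm_of_nonneg (Nat.cast_nonneg _), Real.norm_of_nonneg hpos]
  exact (ncard_records_le_sum_coeff s n t hx0 hx1).trans (mul_le_mul_of_nonneg_right ht hpos)
end
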